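/- arXiv:math/0211103 — 3 statements merged into one kernel-verified Lean document; each statement's English description precedes it below -/
import Mathlib

section
/- Let ρ > 0 and let μ be a probability measure on ℝ^d with density exp(−H) with respect to Lebesgue measure, where H : ℝ^d → ℝ is a smooth function whose Hessian satisfies ⟨Hess H(x) y, y⟩ ≥ ρ·‖y‖² for all x, y ∈ ℝ^d. Then for every q ∈ [1, 2) and every smooth bounded function f : ℝ^d → ℝ with bounded gradient, ∫ f² dμ − (∫ |f|^q dμ)^{2/q} ≤ ((2 − q)/ρ) · ∫ ‖∇f‖² dμ. -/
open MeasureTheory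

set_option linter.unusedSectionVars false

/-- A function with bounded derivative (by `K`) which is Lipschitz (with constant `L`). -/
structure IsC11 {E : Type*} [NormedAddCommGroup E] [NormedSpace ℝ E] (K L : ℝ) (g : E → ℝ) :
    Prop where
  differentiable : Differentiable ℝ g
  norm_le : ∀ x, ‖fderiv ℝ g x‖ ≤ K
  lip : ∀ x y, ‖fderiv ℝ g x - fderiv ℝ g y‖ ≤ L * ‖x - y‖

/-- A finitely supported probability measure on `E`, with weights `w` and atoms `v`, which is
centred and has identity covariance. -/
structure IsotropicNoise (ι E : Type*) [Fintype ι] [NormedAddCommGroup E]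
    [InnerProductSpace ℝ E] where
  w : ι → ℝ
  v : ι → E
  r : ℝ
  w_nonneg : ∀ i, 0 ≤ w i
  w_sum : ∑ i, w i = 1
  mean : ∑ i, w i • v i = 0
  cov : ∀ x y, ∑ i, w i * (inner ℝ x (v i) * inner ℝ y (v i)) = inner ℝ x y
  norm_le : ∀ i, ‖v i‖ ≤ r
  r_nonneg : 0 ≤ r

/-- Regularity of a drift `b`: strong monotonicity, Lipschitz continuity, and Lipschitz
continuity of the derivative. -/
structure IsRegularDrift {E : Type*} [NormedAddCommGroup E] [InnerProductSpace ℝ E]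
    (ρ M A : ℝ) (b : E → E) : Prop where
  differentiable : Differentiable ℝ b
  mono : ∀ x y, ρ * ‖x - y‖ ^ 2 ≤ inner ℝ (b x - b y) (x - y)
  lip : ∀ x y, ‖b x - b y‖ ≤ M * ‖x - y‖
  fderiv_lip : ∀ x y, ‖fderiv ℝ b x - fderiv ℝ b y‖ ≤ A * ‖x - y‖

/-- One explicit Euler step, of length `s ^ 2 / 2`, for the flow of `-b`. -/
noncomputable def eulerMap {E : Type*} [NormedAddCommGroup E] [NormedSpace ℝ E]
    (b : E → E) (s : ℝ) (x : E) : E := x - (s ^ 2 / 2) • b x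

/-- The Markov operator of the discretized Langevin dynamics. -/
noncomputable def IsotropicNoise.step {ι E : Type*} [Fintype ι] [NormedAddCommGroup E]
    [InnerProductSpace ℝ E] (N : IsotropicNoise ι E) (b : E → E) (s : ℝ) (g : E → ℝ) (x : E) : ℝ :=
  ∑ i, N.w i * g (eulerMap b s x + s • N.v i)

/-- Smallness conditions on the step size. -/
structure IsSmallStep (ρ M s : ℝ) : Prop where
  pos : 0 < s
  le_one : s ≤ 1
  sq_mul_le : s ^ 2 * ρ ≤ 2
  sq_mul_sq_le : s ^ 2 * M ^ 2 ≤ 2 * ρ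
  sq_le_sq : ρ ^ 2 ≤ M ^ 2

namespace IsC11

variable {E : Type*} [NormedAddCommGroup E] [NormedSpace ℝ E] {K L : ℝ} {g : E → ℝ}

lemma nonneg (hg : IsC11 K L g) : 0 ≤ K := (norm_nonneg _).trans (hg.norm_le 0)

lemma continuous_fderiv (hg : IsC11 K L g) : Continuous (fderiv ℝ g) := by
  have : LipschitzWith (Real.toNNReal L) (fderiv ℝ g) := by
    refine LipschitzWith.of_dist_le_mul fun x y => ?_
    rw [dist_eq_norm, dist_eq_norm]
    refine (hg.lip x y).trans ?_
    gcongr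
    exact Real.le_coe_toNNReal L
  exact this.continuous

lemma abs_sub_le (hg : IsC11 K L g) (x y : E) : |g x - g y| ≤ K * ‖x - y‖ := by
  have := Convex.norm_image_sub_le_of_norm_fderiv_le (f := g) (s := Set.univ) (C := K) (𝕜 := ℝ)
    (fun x _ => hg.differentiable x) (fun x _ => hg.norm_le x) convex_univ (Set.mem_univ y)
    (Set.mem_univ x)
  simpa using this

lemma abs_taylor_le (hg : IsC11 K L g) (hL : 0 ≤ L) (x v : E) :
    |g (x + v) - g x - fderiv ℝ g x v| ≤ L * ‖v‖ ^ 2 := by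
  have := Convex.norm_image_sub_le_of_norm_fderiv_le' (f := g) (s := Metric.closedBall x ‖v‖)
    (C := L * ‖v‖) (𝕜 := ℝ) (x := x) (y := x + v) (φ := fderiv ℝ g x)
    (fun x _ => hg.differentiable x) (fun y hy => (hg.lip y x).trans (by
      gcongr; simpa [dist_eq_norm] using hy)) (convex_closedBall _ _)
      (by simp) (by simp)
  simp only [add_sub_cancel_left, Real.norm_eq_abs] at this
  linarith [this, sq ‖v‖, mul_assoc L ‖v‖ ‖v‖]

lemma mono {K' L' : ℝ} (hg : IsC11 K L g) (hK : K ≤ K') (hL : L ≤ L') : IsC11 K' L' g :=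
  ⟨hg.differentiable, fun x => (hg.norm_le x).trans hK, fun x y => (hg.lip x y).trans (by gcongr)⟩

end IsC11

section Step

variable {ι E : Type*} [Fintype ι] [NormedAddCommGroup E] [InnerProductSpace ℝ E]
  {ρ M A s : ℝ} {b : E → E}

lemma IsRegularDrift.norm_eulerMap_sub_sq_le (hb : IsRegularDrift ρ M A b) (s : ℝ) (x y : E) :
    ‖eulerMap b s x - eulerMap b s y‖ ^ 2
      ≤ (1 - s ^ 2 * ρ + s ^ 4 / 4 * M ^ 2) * ‖x - y‖ ^ 2 := by
  have h : eulerMap b s x - eulerMap b s y = (x - y) - (s ^ 2 / 2) • (b x - b y) := by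
    simp only [eulerMap, smul_sub]; abel
  rw [h, norm_sub_sq_real, inner_smul_right, norm_smul, real_inner_comm, mul_pow]
  have h1 := hb.mono x y
  have h2 : ‖b x - b y‖ ^ 2 ≤ (M * ‖x - y‖) ^ 2 :=
    pow_le_pow_left₀ (norm_nonneg _) (hb.lip x y) 2
  have h3 : ‖s ^ 2 / 2‖ ^ 2 = s ^ 4 / 4 := by rw [Real.norm_eq_abs, sq_abs]; ring
  rw [h3]
  have h4 : (0 : ℝ) ≤ s ^ 4 / 4 := by positivity
  nlinarith [mul_le_mul_of_nonneg_left h1 (sq_nonneg s), mul_le_mul_of_nonneg_left h2 h4]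

lemma IsRegularDrift.norm_eulerMap_sub_le (hb : IsRegularDrift ρ M A b) (hs : IsSmallStep ρ M s)
    (x y : E) :
    ‖eulerMap b s x - eulerMap b s y‖ ≤ (1 - s ^ 2 * ρ / 4) * ‖x - y‖ := by
  have h0 : 0 ≤ 1 - s ^ 2 * ρ / 4 := by linarith [hs.sq_mul_le]
  refine abs_le_of_sq_le_sq' ?_ (by positivity) |>.2
  refine (hb.norm_eulerMap_sub_sq_le s x y).trans ?_
  rw [mul_pow]
  gcongr
  nlinarith [hs.sq_mul_sq_le, sq_nonneg (s ^ 2 * ρ), sq_nonneg s]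

lemma IsRegularDrift.differentiable_eulerMap (hb : IsRegularDrift ρ M A b) (s : ℝ) :
    Differentiable ℝ (eulerMap b s) :=
  differentiable_id.sub (hb.differentiable.const_smul _)

lemma IsRegularDrift.fderiv_eulerMap (hb : IsRegularDrift ρ M A b) (s : ℝ) (x : E) :
    fderiv ℝ (eulerMap b s) x = ContinuousLinearMap.id ℝ E - (s ^ 2 / 2) • fderiv ℝ b x :=
  ((hasFDerivAt_id x).sub ((hb.differentiable x).hasFDerivAt.const_smul _)).fderiv

lemma IsRegularDrift.norm_fderiv_eulerMap_le (hb : IsRegularDrift ρ M A b)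
    (hs : IsSmallStep ρ M s) (x : E) : ‖fderiv ℝ (eulerMap b s) x‖ ≤ 1 - s ^ 2 * ρ / 4 :=
  norm_fderiv_le_of_lip' ℝ (by linarith [hs.sq_mul_le])
    (Filter.Eventually.of_forall fun y => hb.norm_eulerMap_sub_le hs y x)

lemma IsRegularDrift.norm_fderiv_eulerMap_sq_le (hb : IsRegularDrift ρ M A b)
    (hs : IsSmallStep ρ M s) (x : E) :
    ‖fderiv ℝ (eulerMap b s) x‖ ^ 2 ≤ 1 - s ^ 2 * ρ + s ^ 4 / 4 * M ^ 2 := by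
  have h0 : 0 ≤ 1 - s ^ 2 * ρ + s ^ 4 / 4 * M ^ 2 := by
    nlinarith [mul_le_mul_of_nonneg_left hs.sq_le_sq (by positivity : 0 ≤ s ^ 4 / 4),
      sq_nonneg (s ^ 2 * ρ - 2)]
  have h : ‖fderiv ℝ (eulerMap b s) x‖ ≤ √(1 - s ^ 2 * ρ + s ^ 4 / 4 * M ^ 2) := by
    refine norm_fderiv_le_of_lip' ℝ (Real.sqrt_nonneg _) (Filter.Eventually.of_forall fun y => ?_)
    refine abs_le_of_sq_le_sq' ?_ (by positivity) |>.2
    rw [mul_pow, Real.sq_sqrt h0]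
    exact hb.norm_eulerMap_sub_sq_le s y x
  calc _ ≤ √(1 - s ^ 2 * ρ + s ^ 4 / 4 * M ^ 2) ^ 2 := by gcongr
    _ = _ := Real.sq_sqrt h0

namespace IsotropicNoise

variable (N : IsotropicNoise ι E)

lemma norm_sum_smul_le {F : Type*} [NormedAddCommGroup F] [NormedSpace ℝ F] {u : ι → F} {C : ℝ}
    (h : ∀ i, ‖u i‖ ≤ C) : ‖∑ i, N.w i • u i‖ ≤ C := by
  calc ‖∑ i, N.w i • u i‖ ≤ ∑ i, N.w i * C := by
        refine (norm_sum_le _ _).trans (Finset.sum_le_sum fun i _ => ?_)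
        rw [norm_smul, Real.norm_eq_abs, abs_of_nonneg (N.w_nonneg i)]
        exact mul_le_mul_of_nonneg_left (h i) (N.w_nonneg i)
    _ = C := by rw [← Finset.sum_mul, N.w_sum, one_mul]

lemma sum_mul_le {u : ι → ℝ} {C : ℝ} (h : ∀ i, u i ≤ C) : ∑ i, N.w i * u i ≤ C := by
  calc ∑ i, N.w i * u i ≤ ∑ i, N.w i * C :=
        Finset.sum_le_sum fun i _ => mul_le_mul_of_nonneg_left (h i) (N.w_nonneg i)
    _ = C := by rw [← Finset.sum_mul, N.w_sum, one_mul]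

lemma le_sum_mul {u : ι → ℝ} {C : ℝ} (h : ∀ i, C ≤ u i) : C ≤ ∑ i, N.w i * u i := by
  calc C = ∑ i, N.w i * C := by rw [← Finset.sum_mul, N.w_sum, one_mul]
    _ ≤ ∑ i, N.w i * u i :=
        Finset.sum_le_sum fun i _ => mul_le_mul_of_nonneg_left (h i) (N.w_nonneg i)

lemma step_mem_Icc {g : E → ℝ} {m₀ m₁ : ℝ} (hg : ∀ x, g x ∈ Set.Icc m₀ m₁) (b : E → E) (s : ℝ)
    (x : E) : N.step b s g x ∈ Set.Icc m₀ m₁ :=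
  ⟨N.le_sum_mul fun _ => (hg _).1, N.sum_mul_le fun _ => (hg _).2⟩

lemma step_mono {f g : E → ℝ} (h : ∀ x, f x ≤ g x) (b : E → E) (s : ℝ) (x : E) :
    N.step b s f x ≤ N.step b s g x :=
  Finset.sum_le_sum fun i _ => mul_le_mul_of_nonneg_left (h _) (N.w_nonneg i)

lemma step_const_mul (c : ℝ) (g : E → ℝ) (b : E → E) (s : ℝ) :
    N.step b s (fun x => c * g x) = fun x => c * N.step b s g x := by
  funext x
  simp only [step, Finset.mul_sum]
  exact Finset.sum_congr rfl fun i _ => by ring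

lemma hasFDerivAt_step (hb : IsRegularDrift ρ M A b) {g : E → ℝ} (hg : Differentiable ℝ g) (s : ℝ)
    (x : E) : HasFDerivAt (N.step b s g)
      (∑ i, N.w i • (fderiv ℝ g (eulerMap b s x + s • N.v i)).comp (fderiv ℝ (eulerMap b s) x))
      x := by
  unfold step
  refine HasFDerivAt.fun_sum fun i _ => ?_
  refine HasFDerivAt.const_mul ?_ _
  exact (hg _).hasFDerivAt.comp x ((hb.differentiable_eulerMap s x).hasFDerivAt.add_const _)

lemma isC11_step (hb : IsRegularDrift ρ M A b) (hρ : 0 < ρ) (hA : 0 ≤ A)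
    (hs : IsSmallStep ρ M s) {g : E → ℝ} {K B : ℝ} (hB : 4 * A ≤ ρ * B)
    (hg : IsC11 K (B * K) g) :
    IsC11 ((1 - s ^ 2 * ρ / 4) * K) (B * ((1 - s ^ 2 * ρ / 4) * K)) (N.step b s g) := by
  have hη : 0 ≤ 1 - s ^ 2 * ρ / 4 := by linarith [hs.sq_mul_le]
  have hK := hg.nonneg
  have hB0 : 0 ≤ B := by
    by_contra h
    nlinarith
  refine ⟨fun x => (N.hasFDerivAt_step hb hg.differentiable s x).differentiableAt, fun x => ?_,
    fun x y => ?_⟩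
  · rw [(N.hasFDerivAt_step hb hg.differentiable s x).fderiv]
    refine N.norm_sum_smul_le fun i => ?_
    refine (ContinuousLinearMap.opNorm_comp_le _ _).trans ?_
    rw [mul_comm]
    exact mul_le_mul (hb.norm_fderiv_eulerMap_le hs x) (hg.norm_le _) (norm_nonneg _) hη
  · rw [(N.hasFDerivAt_step hb hg.differentiable s x).fderiv,
      (N.hasFDerivAt_step hb hg.differentiable s y).fderiv, ← Finset.sum_sub_distrib]
    simp only [← smul_sub]
    refine N.norm_sum_smul_le fun i => ?_
    set T := eulerMap b s
    set p := fderiv ℝ g (T x + s • N.v i)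
    set q := fderiv ℝ g (T y + s • N.v i)
    have h1 : p.comp (fderiv ℝ T x) - q.comp (fderiv ℝ T y)
        = (p - q).comp (fderiv ℝ T x) + q.comp (fderiv ℝ T x - fderiv ℝ T y) := by
      ext z; simp
    have h2 : ‖p - q‖ ≤ B * K * ((1 - s ^ 2 * ρ / 4) * ‖x - y‖) := by
      refine (hg.lip _ _).trans ?_
      have : T x + s • N.v i - (T y + s • N.v i) = T x - T y := by abel
      rw [this]
      exact mul_le_mul_of_nonneg_left (hb.norm_eulerMap_sub_le hs x y) (by positivity)
    have h3 : ‖fderiv ℝ T x - fderiv ℝ T y‖ ≤ s ^ 2 / 2 * (A * ‖x - y‖) := by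
      rw [hb.fderiv_eulerMap, hb.fderiv_eulerMap]
      have : ContinuousLinearMap.id ℝ E - (s ^ 2 / 2) • fderiv ℝ b x
          - (ContinuousLinearMap.id ℝ E - (s ^ 2 / 2) • fderiv ℝ b y)
          = (s ^ 2 / 2) • (fderiv ℝ b y - fderiv ℝ b x) := by
        rw [smul_sub]; abel
      rw [this, norm_smul, Real.norm_of_nonneg (by positivity), norm_sub_rev]
      exact mul_le_mul_of_nonneg_left (hb.fderiv_lip x y) (by positivity)
    rw [h1]
    calc _ ≤ ‖p - q‖ * ‖fderiv ℝ T x‖ + ‖q‖ * ‖fderiv ℝ T x - fderiv ℝ T y‖ :=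
          (norm_add_le _ _).trans (add_le_add (ContinuousLinearMap.opNorm_comp_le _ _)
            (ContinuousLinearMap.opNorm_comp_le _ _))
      _ ≤ B * K * ((1 - s ^ 2 * ρ / 4) * ‖x - y‖) * (1 - s ^ 2 * ρ / 4)
          + K * (s ^ 2 / 2 * (A * ‖x - y‖)) := by
          gcongr
          · exact hb.norm_fderiv_eulerMap_le hs x
          · exact hg.norm_le _
      _ ≤ _ := by
          have h4 : 0 ≤ K * ‖x - y‖ * s ^ 2 := by positivity
          have h5 : B * (1 - s ^ 2 * ρ / 4) * (1 - s ^ 2 * ρ / 4) + s ^ 2 / 2 * A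
              ≤ B * (1 - s ^ 2 * ρ / 4) := by
            have h6 : s ^ 2 * (4 * A) ≤ s ^ 2 * (ρ * B) :=
              mul_le_mul_of_nonneg_left hB (sq_nonneg s)
            have h7 : 0 ≤ (2 - s ^ 2 * ρ) * (B * (s ^ 2 * ρ)) :=
              mul_nonneg (by linarith [hs.sq_mul_le]) (by positivity)
            nlinarith
          calc _ = (B * (1 - s ^ 2 * ρ / 4) * (1 - s ^ 2 * ρ / 4) + s ^ 2 / 2 * A)
                * (K * ‖x - y‖) := by ring
            _ ≤ B * (1 - s ^ 2 * ρ / 4) * (K * ‖x - y‖) := by gcongr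
            _ = _ := by ring

end IsotropicNoise

end Step

/-- `Φ`, with first two derivatives `Φ'` and `Φ''`, is a convex function on `[m₀, m₁]` with
derivatives controlled by `C`, for which `(x, y) ↦ Φ''(x) y ^ 2` is jointly convex. -/
structure IsEntropy (m₀ m₁ C : ℝ) (Φ Φ' Φ'' : ℝ → ℝ) : Prop where
  hasDerivAt : ∀ x ∈ Set.Icc m₀ m₁, HasDerivAt Φ (Φ' x) x
  abs_le : ∀ x ∈ Set.Icc m₀ m₁, |Φ x| ≤ C
  abs_deriv_le : ∀ x ∈ Set.Icc m₀ m₁, |Φ' x| ≤ C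
  deriv_lip : ∀ x ∈ Set.Icc m₀ m₁, ∀ y ∈ Set.Icc m₀ m₁, |Φ' x - Φ' y| ≤ C * |x - y|
  deriv2_mem : ∀ x ∈ Set.Icc m₀ m₁, Φ'' x ∈ Set.Icc 0 C
  tangent_le : ∀ x ∈ Set.Icc m₀ m₁, ∀ y ∈ Set.Icc m₀ m₁, Φ x + Φ' x * (y - x) ≤ Φ y
  le_taylor : ∀ x ∈ Set.Icc m₀ m₁, ∀ y ∈ Set.Icc m₀ m₁,
    Φ y ≤ Φ x + Φ' x * (y - x) + Φ'' x / 2 * (y - x) ^ 2 + C * |y - x| ^ 3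
  jensen : ∀ {ι : Type} [Fintype ι] (w x y : ι → ℝ), (∀ i, 0 ≤ w i) → ∑ i, w i = 1 →
    (∀ i, x i ∈ Set.Icc m₀ m₁) → (∀ i, 0 ≤ y i) →
    Φ'' (∑ i, w i * x i) * (∑ i, w i * y i) ^ 2 ≤ ∑ i, w i * (Φ'' (x i) * y i ^ 2)

section Entropy

variable {ι : Type} {E : Type*} [Fintype ι] [NormedAddCommGroup E] [InnerProductSpace ℝ E]
  {m₀ m₁ C ρ M A s K L B : ℝ} {Φ Φ' Φ'' : ℝ → ℝ} {b : E → E} {g : E → ℝ}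

lemma IsotropicNoise.sum_mul_sq [CompleteSpace E] (N : IsotropicNoise ι E) (φ : E →L[ℝ] ℝ) :
    ∑ i, N.w i * φ (N.v i) ^ 2 = ‖φ‖ ^ 2 := by
  obtain ⟨z, rfl⟩ := (InnerProductSpace.toDual ℝ E).surjective φ
  simp only [InnerProductSpace.toDual_apply_apply, LinearIsometryEquiv.norm_map, sq]
  rw [N.cov z z, real_inner_self_eq_norm_mul_norm]

/-- The local entropy inequality for one step of the noise. -/
lemma IsEntropy.sum_sub_le [CompleteSpace E] (hΦ : IsEntropy m₀ m₁ C Φ Φ' Φ'')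
    (N : IsotropicNoise ι E) (hs : 0 ≤ s) (hL : 0 ≤ L) (hg : IsC11 K L g)
    (hgm : ∀ x, g x ∈ Set.Icc m₀ m₁) (y : E) :
    ∑ i, N.w i * Φ (g (y + s • N.v i)) - Φ (∑ i, N.w i * g (y + s • N.v i))
      ≤ s ^ 2 / 2 * (Φ'' (g y) * ‖fderiv ℝ g y‖ ^ 2)
        + s ^ 3 * (C * N.r ^ 3 * (L * K + K ^ 3)) := by
  have hK := hg.nonneg
  have hr := N.r_nonneg
  set δ : ι → ℝ := fun i => g (y + s • N.v i) - g y with hδ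
  have hC : 0 ≤ C := (hΦ.deriv2_mem _ (hgm y)).1.trans (hΦ.deriv2_mem _ (hgm y)).2
  have hsv : ∀ i, ‖s • N.v i‖ ≤ s * N.r := fun i => by
    rw [norm_smul, Real.norm_of_nonneg hs]
    exact mul_le_mul_of_nonneg_left (N.norm_le i) hs
  have hδ1 : ∀ i, |δ i| ≤ K * (s * N.r) := fun i => by
    refine (hg.abs_sub_le _ _).trans ?_
    rw [add_sub_cancel_left]
    exact mul_le_mul_of_nonneg_left (hsv i) hK
  have hδ2 : ∀ i, δ i ^ 2 ≤ s ^ 2 * fderiv ℝ g y (N.v i) ^ 2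
      + 2 * (L * K * (s * N.r) ^ 3) := fun i => by
    set t := fderiv ℝ g y (s • N.v i) with ht
    have h1 : |δ i - t| ≤ L * (s * N.r) ^ 2 :=
      (hg.abs_taylor_le hL y _).trans (by gcongr; exact hsv i)
    have h2 : |t| ≤ K * (s * N.r) :=
      ((fderiv ℝ g y).le_opNorm _).trans
        (mul_le_mul (hg.norm_le y) (hsv i) (norm_nonneg _) hK)
    have h3 : t ^ 2 = s ^ 2 * fderiv ℝ g y (N.v i) ^ 2 := by
      rw [ht, map_smul, smul_eq_mul, mul_pow]
    have h4 : |δ i + t| ≤ 2 * (K * (s * N.r)) :=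
      (abs_add_le _ _).trans (by linarith [hδ1 i])
    rw [← h3]
    have h5 : (δ i - t) * (δ i + t) ≤ L * (s * N.r) ^ 2 * (2 * (K * (s * N.r))) := by
      refine (le_abs_self _).trans ?_
      rw [abs_mul]
      exact mul_le_mul h1 h4 (abs_nonneg _) (by positivity)
    linarith [h5]
  have hp : ∀ i, Φ (g (y + s • N.v i)) ≤ Φ (g y) + Φ' (g y) * δ i
      + Φ'' (g y) / 2 * (s ^ 2 * fderiv ℝ g y (N.v i) ^ 2)
      + (C * (L * K * (s * N.r) ^ 3) + C * (K * (s * N.r)) ^ 3) := fun i => by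
    have h1 := hΦ.le_taylor _ (hgm y) _ (hgm (y + s • N.v i))
    have h2 := hΦ.deriv2_mem _ (hgm y)
    have h3 : |g (y + s • N.v i) - g y| ^ 3 ≤ (K * (s * N.r)) ^ 3 := by
      gcongr; exact hδ1 i
    have h5 : Φ'' (g y) / 2 * δ i ^ 2 ≤ Φ'' (g y) / 2 * (s ^ 2 * fderiv ℝ g y (N.v i) ^ 2
      + 2 * (L * K * (s * N.r) ^ 3)) :=
      mul_le_mul_of_nonneg_left (hδ2 i) (by linarith [h2.1])
    have h6 : Φ'' (g y) * (L * K * (s * N.r) ^ 3) ≤ C * (L * K * (s * N.r) ^ 3) :=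
      mul_le_mul_of_nonneg_right h2.2 (by positivity)
    have h7 := mul_le_mul_of_nonneg_left h3 hC
    simp only [hδ] at h5 ⊢
    linarith
  have hsum : ∑ i, N.w i * Φ (g (y + s • N.v i)) ≤ Φ (g y) + Φ' (g y) * ∑ i, N.w i * δ i
      + Φ'' (g y) / 2 * (s ^ 2 * ‖fderiv ℝ g y‖ ^ 2)
      + (C * (L * K * (s * N.r) ^ 3) + C * (K * (s * N.r)) ^ 3) := by
    refine (Finset.sum_le_sum fun i _ => mul_le_mul_of_nonneg_left (hp i) (N.w_nonneg i)).trans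
      (le_of_eq ?_)
    rw [← N.sum_mul_sq]
    simp only [mul_add, Finset.sum_add_distrib, ← Finset.sum_mul, N.w_sum, Finset.mul_sum, one_mul]
    congr 2
    · congr 1
      exact Finset.sum_congr rfl fun i _ => by ring
    · exact Finset.sum_congr rfl fun i _ => by ring
  have hmean : ∑ i, N.w i * g (y + s • N.v i) - g y = ∑ i, N.w i * δ i := by
    simp only [hδ, mul_sub, Finset.sum_sub_distrib, ← Finset.sum_mul, N.w_sum, one_mul]
  have htan := hΦ.tangent_le _ (hgm y) (∑ i, N.w i * g (y + s • N.v i))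
    ⟨N.le_sum_mul fun _ => (hgm _).1, N.sum_mul_le fun _ => (hgm _).2⟩
  rw [hmean] at htan
  calc _ ≤ _ := sub_le_sub hsum htan
    _ = _ := by ring

/-- The energy density `Φ''(g) ‖∇g‖ ^ 2` contracts along the discretized dynamics. -/
lemma IsEntropy.energy_step_le (hΦ : IsEntropy m₀ m₁ C Φ Φ' Φ'')
    (N : IsotropicNoise ι E) (hb : IsRegularDrift ρ M A b) (hs : IsSmallStep ρ M s)
    (hg : Differentiable ℝ g) (hgm : ∀ x, g x ∈ Set.Icc m₀ m₁) (x : E) :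
    Φ'' (N.step b s g x) * ‖fderiv ℝ (N.step b s g) x‖ ^ 2
      ≤ (1 - s ^ 2 * ρ + s ^ 4 / 4 * M ^ 2)
        * N.step b s (fun x => Φ'' (g x) * ‖fderiv ℝ g x‖ ^ 2) x := by
  have h1 : ‖fderiv ℝ (N.step b s g) x‖
      ≤ (∑ i, N.w i * ‖fderiv ℝ g (eulerMap b s x + s • N.v i)‖)
        * ‖fderiv ℝ (eulerMap b s) x‖ := by
    rw [(N.hasFDerivAt_step hb hg s x).fderiv, Finset.sum_mul]
    refine (norm_sum_le _ _).trans (Finset.sum_le_sum fun i _ => ?_)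
    rw [norm_smul, Real.norm_of_nonneg (N.w_nonneg i), mul_assoc]
    exact mul_le_mul_of_nonneg_left (ContinuousLinearMap.opNorm_comp_le _ _) (N.w_nonneg i)
  have h2 := hΦ.jensen N.w (fun i => g (eulerMap b s x + s • N.v i))
    (fun i => ‖fderiv ℝ g (eulerMap b s x + s • N.v i)‖) N.w_nonneg N.w_sum (fun i => hgm _)
    (fun i => norm_nonneg _)
  have h3 := (hΦ.deriv2_mem _ (N.step_mem_Icc hgm b s x)).1
  have h4 := hb.norm_fderiv_eulerMap_sq_le hs x
  have h5 : ‖fderiv ℝ (N.step b s g) x‖ ^ 2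
      ≤ (1 - s ^ 2 * ρ + s ^ 4 / 4 * M ^ 2)
        * (∑ i, N.w i * ‖fderiv ℝ g (eulerMap b s x + s • N.v i)‖) ^ 2 := by
    refine (pow_le_pow_left₀ (norm_nonneg _) h1 2).trans ?_
    rw [mul_pow, mul_comm]
    gcongr
  calc _ ≤ Φ'' (N.step b s g x) * ((1 - s ^ 2 * ρ + s ^ 4 / 4 * M ^ 2)
        * (∑ i, N.w i * ‖fderiv ℝ g (eulerMap b s x + s • N.v i)‖) ^ 2) :=
        mul_le_mul_of_nonneg_left h5 h3
    _ = (1 - s ^ 2 * ρ + s ^ 4 / 4 * M ^ 2) * (Φ'' (N.step b s g x)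
        * (∑ i, N.w i * ‖fderiv ℝ g (eulerMap b s x + s • N.v i)‖) ^ 2) := by ring
    _ ≤ _ := mul_le_mul_of_nonneg_left h2 ((sq_nonneg _).trans h4)

lemma IsEntropy.isC11_comp (hΦ : IsEntropy m₀ m₁ C Φ Φ' Φ'') {K₀ : ℝ} (hB : 1 ≤ B) (hK : K ≤ K₀)
    (hg : IsC11 K (B * K) g) (hgm : ∀ x, g x ∈ Set.Icc m₀ m₁) :
    IsC11 (C * (1 + K₀) * K) (B * (C * (1 + K₀) * K)) (fun x => Φ (g x)) := by
  have hK0 := hg.nonneg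
  have hC : 0 ≤ C := (hΦ.deriv2_mem _ (hgm 0)).1.trans (hΦ.deriv2_mem _ (hgm 0)).2
  have hd : ∀ x, HasFDerivAt (fun x => Φ (g x)) (Φ' (g x) • fderiv ℝ g x) x := fun x =>
    (hΦ.hasDerivAt _ (hgm x)).comp_hasFDerivAt x (hg.differentiable x).hasFDerivAt
  refine ⟨fun x => (hd x).differentiableAt, fun x => ?_, fun x y => ?_⟩
  · rw [(hd x).fderiv, norm_smul]
    calc _ ≤ C * K := mul_le_mul (hΦ.abs_deriv_le _ (hgm x)) (hg.norm_le x) (norm_nonneg _) hC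
      _ ≤ _ := by nlinarith [mul_nonneg (mul_nonneg hC hK0) (hK0.trans hK)]
  · rw [(hd x).fderiv, (hd y).fderiv]
    have h1 : Φ' (g x) • fderiv ℝ g x - Φ' (g y) • fderiv ℝ g y
        = (Φ' (g x) - Φ' (g y)) • fderiv ℝ g x
          + Φ' (g y) • (fderiv ℝ g x - fderiv ℝ g y) := by
      rw [sub_smul, smul_sub]; abel
    rw [h1]
    have h2 : |Φ' (g x) - Φ' (g y)| ≤ C * (K * ‖x - y‖) :=
      (hΦ.deriv_lip _ (hgm x) _ (hgm y)).trans
        (mul_le_mul_of_nonneg_left (hg.abs_sub_le x y) hC)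
    calc _ ≤ |Φ' (g x) - Φ' (g y)| * ‖fderiv ℝ g x‖
          + |Φ' (g y)| * ‖fderiv ℝ g x - fderiv ℝ g y‖ := by
          refine (norm_add_le _ _).trans ?_
          rw [norm_smul, norm_smul, Real.norm_eq_abs, Real.norm_eq_abs]
      _ ≤ C * (K * ‖x - y‖) * K + C * (B * K * ‖x - y‖) := by
          gcongr
          · exact hg.norm_le x
          · exact hΦ.abs_deriv_le _ (hgm y)
          · exact hg.lip x y
      _ ≤ _ := by
          have h3 : K * 1 ≤ K₀ * B := mul_le_mul hK hB zero_le_one (hK0.trans hK)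
          nlinarith [mul_le_mul_of_nonneg_left h3
            (mul_nonneg (mul_nonneg hC hK0) (norm_nonneg (x - y)))]

end Entropy

/-- The measure `μ` has a second moment, and satisfies the integration by parts formula of a
measure with density `exp (-H)` for which `∇H = b`. -/
structure IsLangevinStationary {E : Type*} [NormedAddCommGroup E] [InnerProductSpace ℝ E]
    [MeasurableSpace E] (μ : Measure E) (b : E → E) : Prop where
  integrable_sq : Integrable (fun x => ‖x‖ ^ 2) μ
  integral_fderiv : ∀ {u : E → ℝ} {K L C : ℝ}, IsC11 K L u → (∀ x, |u x| ≤ C) →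
    ∀ a, ∫ x, fderiv ℝ u x a ∂μ = ∫ x, u x * inner ℝ (b x) a ∂μ

section Stationary

variable {ι E : Type*} [Fintype ι] [NormedAddCommGroup E] [InnerProductSpace ℝ E]
  [FiniteDimensional ℝ E] [MeasurableSpace E] [BorelSpace E] {μ : Measure E}
  [IsProbabilityMeasure μ] {ρ M A s K L B C : ℝ} {b : E → E} {g : E → ℝ}

lemma integrable_of_continuous_of_abs_le {u : E → ℝ} (hu : Continuous u) (h : ∀ x, |u x| ≤ C) :
    Integrable u μ :=
  Integrable.of_bound hu.aestronglyMeasurable C (Filter.Eventually.of_forall h)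

lemma IsRegularDrift.norm_le (hb : IsRegularDrift ρ M A b) (x : E) :
    ‖b x‖ ≤ ‖b 0‖ + M * ‖x‖ := by
  have h := hb.lip x 0
  rw [sub_zero] at h
  linarith [norm_sub_norm_le (b x) (b 0)]

lemma IsLangevinStationary.integrable_norm_sq_drift (hμ : IsLangevinStationary μ b)
    (hb : IsRegularDrift ρ M A b) :
    Integrable (fun x => ‖b x‖ ^ 2) μ := by
  refine Integrable.mono' (((integrable_const (2 * ‖b 0‖ ^ 2)).add
    (hμ.integrable_sq.const_mul (2 * M ^ 2))))
    (hb.differentiable.continuous.norm.pow 2).aestronglyMeasurable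
    (Filter.Eventually.of_forall fun x => ?_)
  rw [Real.norm_of_nonneg (by positivity)]
  have h := pow_le_pow_left₀ (norm_nonneg _) (hb.norm_le x) 2
  simp only [Pi.add_apply]
  nlinarith [sq_nonneg (‖b 0‖ - M * ‖x‖)]

lemma integrable_norm_of_sq {F : Type*} [NormedAddCommGroup F] {f : E → F} (hf : Continuous f)
    (h : Integrable (fun x => ‖f x‖ ^ 2) μ) : Integrable (fun x => ‖f x‖) μ := by
  refine Integrable.mono' ((integrable_const (1 : ℝ)).add h) hf.norm.aestronglyMeasurable
    (Filter.Eventually.of_forall fun x => ?_)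
  rw [norm_norm]
  simp only [Pi.add_apply]
  nlinarith [sq_nonneg (‖f x‖ - 1)]

lemma IsLangevinStationary.integrable_norm_drift (hμ : IsLangevinStationary μ b)
    (hb : IsRegularDrift ρ M A b) :
    Integrable (fun x => ‖b x‖) μ :=
  integrable_norm_of_sq hb.differentiable.continuous (hμ.integrable_norm_sq_drift hb)

/-- Integrability of a bounded continuous multiple of the drift. -/
lemma IsLangevinStationary.integrable_mul_inner (hμ : IsLangevinStationary μ b)
    (hb : IsRegularDrift ρ M A b)
    {u : E → ℝ} (hu : Continuous u) (h : ∀ x, |u x| ≤ C) (a : E) :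
    Integrable (fun x => u x * inner ℝ (b x) a) μ := by
  refine Integrable.bdd_mul (c := C) ?_ hu.aestronglyMeasurable (Filter.Eventually.of_forall h)
  refine Integrable.mono' ((hμ.integrable_norm_drift hb).mul_const ‖a‖)
    (hb.differentiable.continuous.inner continuous_const).aestronglyMeasurable
    (Filter.Eventually.of_forall fun x => norm_inner_le_norm _ _)

lemma IsC11.hasDerivAt_line (hg : IsC11 K L g) (x a : E) (t : ℝ) :
    HasDerivAt (fun t : ℝ => g (x + t • a)) (fderiv ℝ g (x + t • a) a) t := by
  have h1 : HasDerivAt (fun t : ℝ => x + t • a) a t := by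
    simpa using ((hasDerivAt_id t).smul_const a).const_add x
  exact (hg.differentiable _).hasFDerivAt.comp_hasDerivAt t h1

lemma IsC11.shift (hg : IsC11 K L g) (a : E) : IsC11 K L (fun x => g (x + a)) := by
  have h : ∀ x, fderiv ℝ (fun x => g (x + a)) x = fderiv ℝ g (x + a) := fun x => by
    rw [fderiv_comp_add_right]
  refine ⟨fun x => ?_, fun x => by rw [h]; exact hg.norm_le _, fun x y => ?_⟩
  · exact (hg.differentiable _).comp x (differentiableAt_id.add_const a)
  · rw [h, h]; simpa using hg.lip (x + a) (y + a)

lemma IsLangevinStationary.abs_integral_shift_le (hμ : IsLangevinStationary μ b)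
    (hb : IsRegularDrift ρ M A b)
    (hg : IsC11 K L g) (hL : 0 ≤ L) (hgC : ∀ x, |g x| ≤ C) (a : E) :
    |∫ x, g (x + a) ∂μ - ∫ x, g x ∂μ - ∫ x, g x * inner ℝ (b x) a ∂μ
      - (∫ x, fderiv ℝ g x a * inner ℝ (b x) a ∂μ) / 2| ≤ L * ‖a‖ ^ 3 * ∫ x, ‖b x‖ ∂μ := by
  have hgc : Continuous g := hg.differentiable.continuous
  have hK := hg.nonneg
  have hDc : Continuous fun x => fderiv ℝ g x a := hg.continuous_fderiv.clm_apply continuous_const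
  have hDb : ∀ x, |fderiv ℝ g x a| ≤ K * ‖a‖ := fun x =>
    ((fderiv ℝ g x).le_opNorm a).trans (by gcongr; exact hg.norm_le x)
  set I₀ := ∫ x, g x * inner ℝ (b x) a ∂μ
  set I₁ := ∫ x, fderiv ℝ g x a * inner ℝ (b x) a ∂μ
  have hderiv : ∀ t : ℝ, HasDerivAt (fun t : ℝ => ∫ x, g (x + t • a) ∂μ)
      (∫ x, g (x + t • a) * inner ℝ (b x) a ∂μ) t := fun t => by
    rw [← hμ.integral_fderiv (hg.shift (t • a)) (fun x => hgC _) a]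
    simp only [fderiv_comp_add_right]
    refine (hasDerivAt_integral_of_dominated_loc_of_deriv_le (μ := μ) (s := Set.univ)
      (F := fun t x => g (x + t • a)) (F' := fun t x => fderiv ℝ g (x + t • a) a)
      (bound := fun _ => K * ‖a‖) Filter.univ_mem ?_ ?_ ?_ ?_ (integrable_const _) ?_).2
    · exact Filter.Eventually.of_forall fun t =>
        (hgc.comp (continuous_id.add continuous_const)).aestronglyMeasurable
    · exact integrable_of_continuous_of_abs_le (hgc.comp (continuous_id.add continuous_const))
        fun x => hgC _
    · exact (hDc.comp (continuous_id.add continuous_const)).aestronglyMeasurable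
    · exact Filter.Eventually.of_forall fun x t _ => hDb _
    · exact Filter.Eventually.of_forall fun x t _ => hg.hasDerivAt_line x a t
  have hψ : ∀ t : ℝ, HasDerivAt
      (fun t : ℝ => ∫ x, g (x + t • a) ∂μ - t * I₀ - t ^ 2 / 2 * I₁)
      (∫ x, g (x + t • a) * inner ℝ (b x) a ∂μ - I₀ - t * I₁) t := fun t => by
    refine (((hderiv t).sub ((hasDerivAt_id t).mul_const I₀)).sub
      ((((hasDerivAt_id t).pow 2).div_const 2).mul_const I₁)).congr_deriv ?_
    simp
  have hbound : ∀ t ∈ Set.Ico (0 : ℝ) 1,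
      ‖∫ x, g (x + t • a) * inner ℝ (b x) a ∂μ - I₀ - t * I₁‖
        ≤ L * ‖a‖ ^ 3 * ∫ x, ‖b x‖ ∂μ := fun t ht => by
    have i1 := hμ.integrable_mul_inner hb
      (hgc.comp (continuous_id.add (continuous_const (y := t • a)))) (fun x => hgC _) a
    have i2 := hμ.integrable_mul_inner hb hgc hgC a
    have i3 := hμ.integrable_mul_inner hb hDc hDb a
    have e : ∫ x, g (x + t • a) * inner ℝ (b x) a ∂μ - I₀ - t * I₁
        = ∫ x, (g (x + t • a) * inner ℝ (b x) a - g x * inner ℝ (b x) a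
          - t * (fderiv ℝ g x a * inner ℝ (b x) a)) ∂μ := by
      exact ((integral_sub (i1.sub i2) (i3.const_mul t)).trans
        (congrArg₂ _ (integral_sub i1 i2) (integral_const_mul _ _))).symm
    rw [e, ← integral_const_mul]
    refine norm_integral_le_of_norm_le ((hμ.integrable_norm_drift hb).const_mul _)
      (Filter.Eventually.of_forall fun x => ?_)
    have h1 := hg.abs_taylor_le hL x (t • a)
    rw [map_smul, smul_eq_mul, norm_smul, Real.norm_of_nonneg ht.1, mul_pow] at h1
    have h2 : |inner ℝ (b x) a| ≤ ‖b x‖ * ‖a‖ := abs_real_inner_le_norm _ _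
    have h3 : t ^ 2 ≤ 1 := pow_le_one₀ ht.1 ht.2.le
    calc _ = |g (x + t • a) - g x - t * fderiv ℝ g x a| * |inner ℝ (b x) a| := by
          rw [← abs_mul, Real.norm_eq_abs]; ring_nf
      _ ≤ (L * (1 * ‖a‖ ^ 2)) * (‖b x‖ * ‖a‖) := by
          refine mul_le_mul (h1.trans ?_) h2 (abs_nonneg _) (by positivity)
          gcongr
      _ = _ := by ring
  have := norm_image_sub_le_of_norm_deriv_le_segment_01'
    (fun t _ => (hψ t).hasDerivWithinAt) hbound
  simp only [one_smul, zero_smul, add_zero, Real.norm_eq_abs] at this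
  convert this using 2
  ring

/-- One step of the discretized dynamics almost preserves the stationary measure. -/
lemma IsLangevinStationary.abs_integral_step_le (hμ : IsLangevinStationary μ b)
    (hb : IsRegularDrift ρ M A b)
    (N : IsotropicNoise ι E) (hs : IsSmallStep ρ M s)
    (hg : IsC11 K L g) (hL : 0 ≤ L) (hgC : ∀ x, |g x| ≤ C) :
    |∫ x, N.step b s g x ∂μ - ∫ x, g x ∂μ|
      ≤ s ^ 3 * L * (∫ x, ‖b x‖ ^ 2 ∂μ + (N.r + N.r ^ 3) * ∫ x, ‖b x‖ ∂μ) := by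
  have hs0 := hs.pos.le
  have hr := N.r_nonneg
  have hbc := hb.differentiable.continuous
  have hgc : Continuous g := hg.differentiable.continuous
  have hDc : ∀ a, Continuous fun x => fderiv ℝ g x a := fun a =>
    hg.continuous_fderiv.clm_apply continuous_const
  have hDb : ∀ a x, |fderiv ℝ g x a| ≤ K * ‖a‖ := fun a x =>
    ((fderiv ℝ g x).le_opNorm a).trans (by gcongr; exact hg.norm_le x)
  set B₁ := ∫ x, ‖b x‖ ∂μ
  set B₂ := ∫ x, ‖b x‖ ^ 2 ∂μ
  have hB₁ : 0 ≤ B₁ := integral_nonneg fun x => norm_nonneg _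
  have hB₂ : 0 ≤ B₂ := integral_nonneg fun x => sq_nonneg _
  have hsv : ∀ i, ‖s • N.v i‖ ≤ s * N.r := fun i => by
    rw [norm_smul, Real.norm_of_nonneg hs0]
    exact mul_le_mul_of_nonneg_left (N.norm_le i) hs0
  have iD : Integrable (fun x => fderiv ℝ g x (b x)) μ := by
    refine Integrable.mono' ((hμ.integrable_norm_drift hb).const_mul K)
      (hg.continuous_fderiv.clm_apply hbc).aestronglyMeasurable
      (Filter.Eventually.of_forall fun x => ?_)
    exact ((fderiv ℝ g x).le_opNorm _).trans (by gcongr; exact hg.norm_le x)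
  have ig : ∀ a, Integrable (fun x => g (x + a)) μ := fun a =>
    integrable_of_continuous_of_abs_le (hgc.comp (continuous_id.add continuous_const))
      fun x => hgC _
  have iS : Integrable (fun x => N.step b s g x) μ := by
    unfold IsotropicNoise.step eulerMap
    refine integrable_finsetSum _ fun i _ => Integrable.const_mul ?_ _
    exact integrable_of_continuous_of_abs_le (hgc.comp (by fun_prop)) fun x => hgC _
  have iN : Integrable (fun x => ∑ i, N.w i * g (x + s • N.v i)) μ :=
    integrable_finsetSum _ fun i _ => (ig _).const_mul _
  -- the drift part
  have h1 : |∫ x, N.step b s g x ∂μ - ∫ x, ∑ i, N.w i * g (x + s • N.v i) ∂μ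
      + s ^ 2 / 2 * ∫ x, fderiv ℝ g x (b x) ∂μ| ≤ s ^ 3 * L * (B₂ + N.r * B₁) := by
    have e : ∫ x, N.step b s g x ∂μ - ∫ x, ∑ i, N.w i * g (x + s • N.v i) ∂μ
        + s ^ 2 / 2 * ∫ x, fderiv ℝ g x (b x) ∂μ
        = ∫ x, (N.step b s g x - ∑ i, N.w i * g (x + s • N.v i)
          + s ^ 2 / 2 * fderiv ℝ g x (b x)) ∂μ := by
      exact ((integral_add (iS.sub iN) (iD.const_mul _)).trans
        (congrArg₂ _ (integral_sub iS iN) (integral_const_mul _ _))).symm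
    rw [e]
    have e2 : s ^ 3 * L * (B₂ + N.r * B₁)
        = ∫ x, s ^ 3 * L * (‖b x‖ ^ 2 + N.r * ‖b x‖) ∂μ := by
      rw [integral_const_mul, integral_add (hμ.integrable_norm_sq_drift hb)
        ((hμ.integrable_norm_drift hb).const_mul _), integral_const_mul]
    rw [e2, ← Real.norm_eq_abs]
    refine norm_integral_le_of_norm_le (g := fun x => s ^ 3 * L * (‖b x‖ ^ 2 + N.r * ‖b x‖))
      (((hμ.integrable_norm_sq_drift hb).add
      ((hμ.integrable_norm_drift hb).const_mul _)).const_mul _)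
      (Filter.Eventually.of_forall fun x => ?_)
    have e3 : N.step b s g x - ∑ i, N.w i * g (x + s • N.v i) + s ^ 2 / 2 * fderiv ℝ g x (b x)
        = ∑ i, N.w i • (g (eulerMap b s x + s • N.v i) - g (x + s • N.v i)
          + s ^ 2 / 2 * fderiv ℝ g x (b x)) := by
      simp only [IsotropicNoise.step, smul_eq_mul, mul_add, mul_sub, Finset.sum_add_distrib,
        Finset.sum_sub_distrib, ← Finset.sum_mul, N.w_sum, one_mul]
    rw [e3]
    refine N.norm_sum_smul_le fun i => ?_
    set z := x + s • N.v i with hz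
    set a := -((s ^ 2 / 2) • b x) with ha
    have e4 : eulerMap b s x + s • N.v i = z + a := by
      rw [eulerMap, hz, ha]; abel
    have e5 : s ^ 2 / 2 * fderiv ℝ g x (b x) = - fderiv ℝ g x a := by
      rw [ha, map_neg, map_smul, smul_eq_mul, neg_neg]
    have hna : ‖a‖ = s ^ 2 / 2 * ‖b x‖ := by
      rw [ha, norm_neg, norm_smul, Real.norm_of_nonneg (by positivity)]
    have t1 := hg.abs_taylor_le hL z a
    have t2 : |(fderiv ℝ g z - fderiv ℝ g x) a| ≤ L * (s * N.r) * ‖a‖ := by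
      refine ((fderiv ℝ g z - fderiv ℝ g x).le_opNorm a).trans ?_
      gcongr
      refine (hg.lip z x).trans ?_
      gcongr
      simpa [hz] using hsv i
    rw [e4, e5, Real.norm_eq_abs]
    have e6 : g (z + a) - g z + -(fderiv ℝ g x a)
        = (g (z + a) - g z - fderiv ℝ g z a) + (fderiv ℝ g z - fderiv ℝ g x) a := by
      rw [sub_apply]; ring
    rw [e6]
    refine (abs_add_le _ _).trans ((add_le_add t1 t2).trans ?_)
    rw [hna]
    have hp : s ^ 4 ≤ s ^ 3 := pow_le_pow_of_le_one hs0 hs.le_one (by norm_num)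
    have q1 : L * ‖b x‖ ^ 2 * s ^ 4 ≤ L * ‖b x‖ ^ 2 * s ^ 3 :=
      mul_le_mul_of_nonneg_left hp (by positivity)
    have q2 : 0 ≤ L * ‖b x‖ ^ 2 * s ^ 3 := by positivity
    have q3 : 0 ≤ L * (s ^ 3 * N.r * ‖b x‖) := by positivity
    nlinarith
  -- the noise part
  have h2 : |∫ x, ∑ i, N.w i * g (x + s • N.v i) ∂μ - ∫ x, g x ∂μ
      - s ^ 2 / 2 * ∫ x, fderiv ℝ g x (b x) ∂μ| ≤ s ^ 3 * L * (N.r ^ 3 * B₁) := by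
    have z1 : ∑ i, N.w i * ∫ x, g x * inner ℝ (b x) (s • N.v i) ∂μ = 0 := by
      simp only [← integral_const_mul]
      rw [← integral_finsetSum _ fun i _ =>
        (hμ.integrable_mul_inner hb hgc hgC (s • N.v i)).const_mul _]
      have : ∀ x, ∑ i, N.w i * (g x * inner ℝ (b x) (s • N.v i)) = 0 := fun x => by
        have e : ∀ i, N.w i * (g x * inner ℝ (b x) (s • N.v i))
            = g x * s * inner ℝ (b x) (N.w i • N.v i) := fun i => by
          rw [inner_smul_right, inner_smul_right]; ring
        simp only [e]
        rw [← Finset.mul_sum, ← inner_sum, N.mean, inner_zero_right, mul_zero]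
      simp [this]
    have z2 : ∑ i, N.w i * ((∫ x, fderiv ℝ g x (s • N.v i) * inner ℝ (b x) (s • N.v i) ∂μ) / 2)
        = s ^ 2 / 2 * ∫ x, fderiv ℝ g x (b x) ∂μ := by
      simp only [← integral_const_mul, div_eq_mul_inv, ← integral_mul_const]
      rw [← integral_finsetSum _ fun i _ =>
        ((hμ.integrable_mul_inner hb (hDc _) (hDb _) (s • N.v i)).mul_const _).const_mul _]
      refine integral_congr_ae (Filter.Eventually.of_forall fun x => ?_)
      obtain ⟨z, hz⟩ := (InnerProductSpace.toDual ℝ E).surjective (fderiv ℝ g x)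
      simp only [← hz, InnerProductSpace.toDual_apply_apply, ← N.cov z (b x), Finset.mul_sum,
        inner_smul_right]
      exact Finset.sum_congr rfl fun i _ => by ring
    have e : ∫ x, ∑ i, N.w i * g (x + s • N.v i) ∂μ - ∫ x, g x ∂μ
        - s ^ 2 / 2 * ∫ x, fderiv ℝ g x (b x) ∂μ
        = ∑ i, N.w i • (∫ x, g (x + s • N.v i) ∂μ - ∫ x, g x ∂μ
          - ∫ x, g x * inner ℝ (b x) (s • N.v i) ∂μ
          - (∫ x, fderiv ℝ g x (s • N.v i) * inner ℝ (b x) (s • N.v i) ∂μ) / 2) := by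
      simp only [smul_eq_mul, mul_sub, Finset.sum_sub_distrib, ← Finset.sum_mul, N.w_sum, one_mul]
      rw [z1, z2, sub_zero, integral_finsetSum _ fun i _ => (ig _).const_mul _]
      simp only [integral_const_mul]
    rw [e, ← Real.norm_eq_abs]
    refine N.norm_sum_smul_le fun i => ?_
    refine (hμ.abs_integral_shift_le hb hg hL hgC (s • N.v i)).trans ?_
    calc _ ≤ L * (s * N.r) ^ 3 * B₁ := by gcongr; exact hsv i
      _ = _ := by ring
  have e : ∫ x, N.step b s g x ∂μ - ∫ x, g x ∂μ
      = (∫ x, N.step b s g x ∂μ - ∫ x, ∑ i, N.w i * g (x + s • N.v i) ∂μ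
        + s ^ 2 / 2 * ∫ x, fderiv ℝ g x (b x) ∂μ)
        + (∫ x, ∑ i, N.w i * g (x + s • N.v i) ∂μ - ∫ x, g x ∂μ
        - s ^ 2 / 2 * ∫ x, fderiv ℝ g x (b x) ∂μ) := by ring
  rw [e]
  refine (abs_add_le _ _).trans ((add_le_add h1 h2).trans (le_of_eq ?_))
  ring

end Stationary

section Iterate

variable {ι : Type} {E : Type*} [Fintype ι] [NormedAddCommGroup E] [InnerProductSpace ℝ E]
  {m₀ m₁ C ρ M A s K L B D : ℝ} {Φ Φ' Φ'' : ℝ → ℝ} {b : E → E} {g : E → ℝ}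

lemma IsRegularDrift.contraction_nonneg (hb : IsRegularDrift ρ M A b) (hs : IsSmallStep ρ M s) :
    0 ≤ 1 - s ^ 2 * ρ + s ^ 4 / 4 * M ^ 2 :=
  (sq_nonneg _).trans (hb.norm_fderiv_eulerMap_sq_le hs 0)

lemma IsotropicNoise.iterate_step_mem_Icc (N : IsotropicNoise ι E)
    (hg : ∀ x, g x ∈ Set.Icc m₀ m₁) (b : E → E) (s : ℝ) (k : ℕ) (x : E) :
    (N.step b s)^[k] g x ∈ Set.Icc m₀ m₁ := by
  induction k generalizing x with
  | zero => exact hg x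
  | succ k ih =>
    rw [Function.iterate_succ_apply']
    exact N.step_mem_Icc ih b s x

lemma IsotropicNoise.isC11_iterate_step (N : IsotropicNoise ι E) (hb : IsRegularDrift ρ M A b)
    (hρ : 0 < ρ) (hA : 0 ≤ A) (hs : IsSmallStep ρ M s) (hB : 4 * A ≤ ρ * B)
    (hg : IsC11 K (B * K) g) (k : ℕ) :
    IsC11 ((1 - s ^ 2 * ρ / 4) ^ k * K) (B * ((1 - s ^ 2 * ρ / 4) ^ k * K))
      ((N.step b s)^[k] g) := by
  induction k with
  | zero => simpa using hg
  | succ k ih =>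
    rw [Function.iterate_succ_apply', pow_succ', mul_assoc]
    exact N.isC11_step hb hρ hA hs hB ih

/-- Exponential decay of the energy along the discretized dynamics. -/
lemma IsEntropy.energy_iterate_step_le (hΦ : IsEntropy m₀ m₁ C Φ Φ' Φ'')
    (N : IsotropicNoise ι E) (hb : IsRegularDrift ρ M A b) (hρ : 0 < ρ) (hA : 0 ≤ A)
    (hs : IsSmallStep ρ M s) (hB : 4 * A ≤ ρ * B)
    (hg : IsC11 K (B * K) g) (hgm : ∀ x, g x ∈ Set.Icc m₀ m₁) (k : ℕ) (x : E) :
    Φ'' ((N.step b s)^[k] g x) * ‖fderiv ℝ ((N.step b s)^[k] g) x‖ ^ 2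
      ≤ (1 - s ^ 2 * ρ + s ^ 4 / 4 * M ^ 2) ^ k
        * (N.step b s)^[k] (fun x => Φ'' (g x) * ‖fderiv ℝ g x‖ ^ 2) x := by
  induction k generalizing x with
  | zero => simp
  | succ k ih =>
    have hκ := hb.contraction_nonneg hs
    simp only [Function.iterate_succ_apply']
    refine (hΦ.energy_step_le N hb hs (N.isC11_iterate_step hb hρ hA hs hB hg k).differentiable
      (N.iterate_step_mem_Icc hgm b s k) x).trans ?_
    rw [pow_succ' _ k, mul_assoc]
    refine mul_le_mul_of_nonneg_left ((N.step_mono ih b s x).trans (le_of_eq ?_)) hκ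
    rw [N.step_const_mul]

lemma IsEntropy.sub_le (hΦ : IsEntropy m₀ m₁ C Φ Φ' Φ'') {x y : ℝ} (hx : x ∈ Set.Icc m₀ m₁)
    (hy : y ∈ Set.Icc m₀ m₁) : Φ y - Φ x ≤ C * |y - x| := by
  have h1 := hΦ.tangent_le y hy x hx
  have h2 : Φ' y * (y - x) ≤ C * |y - x| := (le_abs_self _).trans (by
    rw [abs_mul]; gcongr; exact hΦ.abs_deriv_le y hy)
  linarith

variable [FiniteDimensional ℝ E] [MeasurableSpace E] [BorelSpace E] {μ : Measure E}
  [IsProbabilityMeasure μ]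

/-- The cumulated defect of invariance of the stationary measure. -/
lemma IsLangevinStationary.abs_integral_iterate_step_le (hμ : IsLangevinStationary μ b)
    (hb : IsRegularDrift ρ M A b) (hρ : 0 < ρ) (hA : 0 ≤ A)
    (N : IsotropicNoise ι E) (hs : IsSmallStep ρ M s) (hB : 4 * A ≤ ρ * B)
    (hg : IsC11 K (B * K) g) (hgm : ∀ x, g x ∈ Set.Icc m₀ m₁) (k : ℕ) :
    |∫ x, (N.step b s)^[k] g x ∂μ - ∫ x, g x ∂μ|
      ≤ s * (4 * B * K * (∫ x, ‖b x‖ ^ 2 ∂μ + (N.r + N.r ^ 3) * ∫ x, ‖b x‖ ∂μ) / ρ)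
        * (1 - (1 - s ^ 2 * ρ / 4) ^ k) := by
  induction k with
  | zero => simp
  | succ k ih =>
    have hη : 0 ≤ 1 - s ^ 2 * ρ / 4 := by linarith [hs.sq_mul_le]
    have hB0 : 0 ≤ B := by nlinarith
    have hK := hg.nonneg
    have h := hμ.abs_integral_step_le hb N hs (N.isC11_iterate_step hb hρ hA hs hB hg k)
      (by positivity) (fun x => abs_le_max_abs_abs (N.iterate_step_mem_Icc hgm b s k x).1
        (N.iterate_step_mem_Icc hgm b s k x).2)
    simp only [Function.iterate_succ_apply']
    refine (abs_sub_le _ (∫ x, (N.step b s)^[k] g x ∂μ) _).trans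
      ((add_le_add h ih).trans (le_of_eq ?_))
    field_simp
    ring

/-- Decay of the entropy in one step of the discretized dynamics. -/
lemma IsLangevinStationary.integral_entropy_step_le (hμ : IsLangevinStationary μ b)
    (hb : IsRegularDrift ρ M A b) (hρ : 0 < ρ) (hA : 0 ≤ A)
    (N : IsotropicNoise ι E) (hΦ : IsEntropy m₀ m₁ C Φ Φ' Φ'')
    (hs : IsSmallStep ρ M s) (hB : 4 * A ≤ ρ * B) (hB1 : 1 ≤ B)
    (hg : IsC11 K (B * K) g) (hgm : ∀ x, g x ∈ Set.Icc m₀ m₁)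
    (hΓ : IsC11 L (B * L) (fun x => Φ'' (g x) * ‖fderiv ℝ g x‖ ^ 2))
    (hΓm : ∀ x, Φ'' (g x) * ‖fderiv ℝ g x‖ ^ 2 ∈ Set.Icc 0 D)
    {C₁ : ℝ} (hC₁ : C₁ = ∫ x, ‖b x‖ ^ 2 ∂μ + (N.r + N.r ^ 3) * ∫ x, ‖b x‖ ∂μ) (k : ℕ) :
    ∫ x, Φ ((N.step b s)^[k] g x) ∂μ - ∫ x, Φ ((N.step b s)^[k + 1] g x) ∂μ
      ≤ s ^ 3 * (B * (C * (1 + K) * K) * C₁ + C * N.r ^ 3 * (B * K + K ^ 2) * K)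
          * (1 - s ^ 2 * ρ / 4) ^ k
        + s ^ 2 / 2 * (1 - s ^ 2 * ρ + s ^ 4 / 4 * M ^ 2) ^ k
          * (∫ x, Φ'' (g x) * ‖fderiv ℝ g x‖ ^ 2 ∂μ
            + s * (4 * B * L * C₁ / ρ + L * ∫ x, ‖b x‖ ∂μ)) := by
  have hη : 0 ≤ 1 - s ^ 2 * ρ / 4 := by linarith [hs.sq_mul_le]
  have hκ := hb.contraction_nonneg hs
  have hs0 := hs.pos.le
  have hη1 : 1 - s ^ 2 * ρ / 4 ≤ 1 := by nlinarith [sq_nonneg s]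
  have hr := N.r_nonneg
  have hC : 0 ≤ C := (hΦ.deriv2_mem _ (hgm 0)).1.trans (hΦ.deriv2_mem _ (hgm 0)).2
  have hB0 : 0 ≤ B := by linarith
  have hK := hg.nonneg
  have hL := hΓ.nonneg
  set η := 1 - s ^ 2 * ρ / 4 with hηdef
  set κ := 1 - s ^ 2 * ρ + s ^ 4 / 4 * M ^ 2 with hκdef
  set Γ : E → ℝ := fun x => Φ'' (g x) * ‖fderiv ℝ g x‖ ^ 2 with hΓdef
  set gk := (N.step b s)^[k] g with hgk
  set B₁ := ∫ x, ‖b x‖ ∂μ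
  have hB₁ : 0 ≤ B₁ := integral_nonneg fun x => norm_nonneg _
  have hC₁0 : 0 ≤ C₁ := by
    rw [hC₁]
    have : 0 ≤ ∫ x, ‖b x‖ ^ 2 ∂μ := integral_nonneg fun x => sq_nonneg _
    positivity
  have hpk : 0 ≤ η ^ k := pow_nonneg hη k
  have hpk1 : η ^ k ≤ 1 := pow_le_one₀ hη hη1
  have hkk : 0 ≤ κ ^ k := pow_nonneg hκ k
  have hKk : η ^ k * K ≤ K := mul_le_of_le_one_left hK hpk1
  have cgk : IsC11 (η ^ k * K) (B * (η ^ k * K)) gk := N.isC11_iterate_step hb hρ hA hs hB hg k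
  have mgk : ∀ x, gk x ∈ Set.Icc m₀ m₁ := N.iterate_step_mem_Icc hgm b s k
  have cΦ := hΦ.isC11_comp hB1 hKk cgk mgk
  have cΓ := N.isC11_iterate_step hb hρ hA hs hB hΓ k
  have mΓ : ∀ x, (N.step b s)^[k] Γ x ∈ Set.Icc 0 D := N.iterate_step_mem_Icc hΓm b s k
  have cgk1 := N.isC11_step hb hρ hA hs hB cgk
  have mgk1 : ∀ x, N.step b s gk x ∈ Set.Icc m₀ m₁ := N.step_mem_Icc mgk b s
  have cΦ1 := hΦ.isC11_comp hB1 le_rfl cgk1 mgk1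
  have cPΦ := N.isC11_step hb hρ hA hs hB cΦ
  -- near invariance
  have h1 : ∫ x, Φ (gk x) ∂μ - ∫ x, N.step b s (fun x => Φ (gk x)) x ∂μ
      ≤ s ^ 3 * (B * (C * (1 + K) * K) * C₁) * η ^ k := by
    have := hμ.abs_integral_step_le hb N hs cΦ (by positivity) (fun x => hΦ.abs_le _ (mgk x))
    rw [abs_sub_comm, ← hC₁] at this
    refine (le_abs_self _).trans (this.trans (le_of_eq ?_))
    ring
  -- pointwise bound
  have h2 : ∀ x, N.step b s (fun x => Φ (gk x)) x - Φ (N.step b s gk x)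
      ≤ s ^ 2 / 2 * (κ ^ k * ((N.step b s)^[k] Γ x + L * s * ‖b x‖))
        + s ^ 3 * (C * N.r ^ 3 * (B * K + K ^ 2) * K) * η ^ k := fun x => by
    refine (hΦ.sum_sub_le N hs0 (by positivity) cgk mgk (eulerMap b s x)).trans ?_
    refine add_le_add (mul_le_mul_of_nonneg_left ?_ (by positivity)) ?_
    · refine (hΦ.energy_iterate_step_le N hb hρ hA hs hB hg hgm k _).trans ?_
      refine mul_le_mul_of_nonneg_left ?_ hkk
      have := (abs_le.1 (cΓ.abs_sub_le (eulerMap b s x) x)).2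
      have e : ‖eulerMap b s x - x‖ = s ^ 2 / 2 * ‖b x‖ := by
        rw [eulerMap, sub_sub_cancel_left, norm_neg, norm_smul, Real.norm_of_nonneg (by positivity)]
      rw [e] at this
      have h3 : η ^ k * L * (s ^ 2 / 2 * ‖b x‖) ≤ 1 * L * (s * ‖b x‖) := by
        gcongr
        nlinarith [hs.le_one]
      change (N.step b s)^[k] Γ (eulerMap b s x) ≤ _
      linarith
    · have : B * (η ^ k * K) * (η ^ k * K) + (η ^ k * K) ^ 3
          ≤ (B * K + K ^ 2) * K * η ^ k := by
        have t1 : η ^ k * η ^ k ≤ η ^ k := mul_le_of_le_one_left hpk hpk1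
        have t2 : η ^ k * η ^ k * η ^ k ≤ η ^ k := (mul_le_of_le_one_right (by positivity) hpk1).trans t1
        calc _ = B * K * K * (η ^ k * η ^ k) + K ^ 3 * (η ^ k * η ^ k * η ^ k) := by ring
          _ ≤ B * K * K * η ^ k + K ^ 3 * η ^ k := by gcongr
          _ = _ := by ring
      calc _ ≤ s ^ 3 * (C * N.r ^ 3 * ((B * K + K ^ 2) * K * η ^ k)) := by gcongr
        _ = _ := by ring
  have iPΦ : Integrable (fun x => N.step b s (fun x => Φ (gk x)) x) μ :=
    integrable_of_continuous_of_abs_le (C := C) cPΦ.differentiable.continuous fun x => abs_le.2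
      (N.step_mem_Icc (g := fun x => Φ (gk x)) (fun x => abs_le.1 (hΦ.abs_le _ (mgk x))) b s x)
  have iΦ1 : Integrable (fun x => Φ (N.step b s gk x)) μ :=
    integrable_of_continuous_of_abs_le cΦ1.differentiable.continuous fun x => hΦ.abs_le _ (mgk1 x)
  have iΓ : Integrable (fun x => (N.step b s)^[k] Γ x) μ :=
    integrable_of_continuous_of_abs_le cΓ.differentiable.continuous
      fun x => abs_le_max_abs_abs (mΓ x).1 (mΓ x).2
  have ib := hμ.integrable_norm_drift hb
  have h3 : ∫ x, N.step b s (fun x => Φ (gk x)) x ∂μ - ∫ x, Φ (N.step b s gk x) ∂μ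
      ≤ s ^ 2 / 2 * (κ ^ k * (∫ x, (N.step b s)^[k] Γ x ∂μ + L * s * B₁))
        + s ^ 3 * (C * N.r ^ 3 * (B * K + K ^ 2) * K) * η ^ k := by
    rw [← integral_sub iPΦ iΦ1]
    have i1 : Integrable (fun x => (N.step b s)^[k] Γ x + L * s * ‖b x‖) μ :=
      iΓ.add (ib.const_mul _)
    refine (integral_mono (iPΦ.sub iΦ1)
      (((i1.const_mul (κ ^ k)).const_mul (s ^ 2 / 2)).add (integrable_const _)) h2).trans
      (le_of_eq ?_)
    refine (integral_add ((i1.const_mul (κ ^ k)).const_mul (s ^ 2 / 2))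
      (integrable_const _)).trans ?_
    rw [integral_const_mul, integral_const_mul, integral_add iΓ (ib.const_mul _),
      integral_const_mul, integral_const, probReal_univ, one_smul]
  have h4 := (abs_le.1 (hμ.abs_integral_iterate_step_le hb hρ hA N hs hB hΓ hΓm k)).2
  rw [← hC₁] at h4
  have h5 : ∫ x, (N.step b s)^[k] Γ x ∂μ ≤ ∫ x, Γ x ∂μ + s * (4 * B * L * C₁ / ρ) := by
    have : s * (4 * B * L * C₁ / ρ) * (1 - η ^ k) ≤ s * (4 * B * L * C₁ / ρ) :=
      mul_le_of_le_one_right (by positivity) (by linarith)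
    linarith
  simp only [Function.iterate_succ_apply', ← hgk]
  have h6 : s ^ 2 / 2 * (κ ^ k * (∫ x, (N.step b s)^[k] Γ x ∂μ + L * s * B₁))
      ≤ s ^ 2 / 2 * κ ^ k * (∫ x, Γ x ∂μ + s * (4 * B * L * C₁ / ρ + L * B₁)) := by
    rw [← mul_assoc]
    refine mul_le_mul_of_nonneg_left ?_ (by positivity)
    linarith
  linarith

/-- The entropy inequality, up to errors vanishing with the size of the time step. -/
lemma IsLangevinStationary.entropy_le_add (hμ : IsLangevinStationary μ b)
    (hb : IsRegularDrift ρ M A b) (hρ : 0 < ρ) (hA : 0 ≤ A)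
    (N : IsotropicNoise ι E) (hΦ : IsEntropy m₀ m₁ C Φ Φ' Φ'')
    (hs : IsSmallStep ρ M s) (hB : 4 * A ≤ ρ * B) (hB1 : 1 ≤ B)
    (hg : IsC11 K (B * K) g) (hgm : ∀ x, g x ∈ Set.Icc m₀ m₁)
    (hΓ : IsC11 L (B * L) (fun x => Φ'' (g x) * ‖fderiv ℝ g x‖ ^ 2))
    (hΓm : ∀ x, Φ'' (g x) * ‖fderiv ℝ g x‖ ^ 2 ∈ Set.Icc 0 D)
    {C₁ : ℝ} (hC₁ : C₁ = ∫ x, ‖b x‖ ^ 2 ∂μ + (N.r + N.r ^ 3) * ∫ x, ‖b x‖ ∂μ) :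
    ∫ x, Φ (g x) ∂μ - Φ (∫ x, g x ∂μ)
      ≤ s * (4 * (B * (C * (1 + K) * K) * C₁ + C * N.r ^ 3 * (B * K + K ^ 2) * K) / ρ
          + C * (4 * B * K * C₁ / ρ))
        + (2 * (ρ - s ^ 2 * M ^ 2 / 4))⁻¹ * (∫ x, Φ'' (g x) * ‖fderiv ℝ g x‖ ^ 2 ∂μ
            + s * (4 * B * L * C₁ / ρ + L * ∫ x, ‖b x‖ ∂μ)) := by
  have hη : 0 ≤ 1 - s ^ 2 * ρ / 4 := by linarith [hs.sq_mul_le]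
  have hκ := hb.contraction_nonneg hs
  have hs0 := hs.pos.le
  have hη1 : 1 - s ^ 2 * ρ / 4 < 1 := by nlinarith [sq_pos_of_pos hs.pos]
  have hr := N.r_nonneg
  have hC : 0 ≤ C := (hΦ.deriv2_mem _ (hgm 0)).1.trans (hΦ.deriv2_mem _ (hgm 0)).2
  have hB0 : 0 ≤ B := by linarith
  have hK := hg.nonneg
  have hL := hΓ.nonneg
  have hR : 0 < ρ - s ^ 2 * M ^ 2 / 4 := by linarith [hs.sq_mul_sq_le]
  have hstep := hμ.integral_entropy_step_le hb hρ hA N hΦ hs hB hB1 hg hgm hΓ hΓm hC₁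
  have hinv := hμ.abs_integral_iterate_step_le hb hρ hA N hs hB hg hgm
  have hreg := N.isC11_iterate_step hb hρ hA hs hB hg
  rw [← hC₁] at hinv
  set B₁ := ∫ x, ‖b x‖ ∂μ
  have hB₁ : 0 ≤ B₁ := integral_nonneg fun x => norm_nonneg _
  have hC₁0 : 0 ≤ C₁ := by
    rw [hC₁]
    have : 0 ≤ ∫ x, ‖b x‖ ^ 2 ∂μ := integral_nonneg fun x => sq_nonneg _
    positivity
  have hI : 0 ≤ ∫ x, Φ'' (g x) * ‖fderiv ℝ g x‖ ^ 2 ∂μ := integral_nonneg fun x => (hΓm x).1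
  set E₁ := B * (C * (1 + K) * K) * C₁ + C * N.r ^ 3 * (B * K + K ^ 2) * K with hE₁
  set W := ∫ x, Φ'' (g x) * ‖fderiv ℝ g x‖ ^ 2 ∂μ + s * (4 * B * L * C₁ / ρ + L * B₁) with hW
  have hE₁0 : 0 ≤ E₁ := by positivity
  have hW0 : 0 ≤ W := by positivity
  have htel : ∀ n, ∫ x, Φ (g x) ∂μ - ∫ x, Φ ((N.step b s)^[n] g x) ∂μ
      ≤ s * (4 * E₁ / ρ) * (1 - (1 - s ^ 2 * ρ / 4) ^ n)
        + (2 * (ρ - s ^ 2 * M ^ 2 / 4))⁻¹ * W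
          * (1 - (1 - s ^ 2 * ρ + s ^ 4 / 4 * M ^ 2) ^ n) := fun n => by
    induction n with
    | zero => simp
    | succ n ih =>
      have e1 : s * (4 * E₁ / ρ) * ((1 - s ^ 2 * ρ / 4) ^ n * (s ^ 2 * ρ / 4))
          = s ^ 3 * E₁ * (1 - s ^ 2 * ρ / 4) ^ n := by
        field_simp
      have e2 : (2 * (ρ - s ^ 2 * M ^ 2 / 4))⁻¹ * W
            * ((1 - s ^ 2 * ρ + s ^ 4 / 4 * M ^ 2) ^ n * (s ^ 2 * (ρ - s ^ 2 * M ^ 2 / 4)))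
          = s ^ 2 / 2 * (1 - s ^ 2 * ρ + s ^ 4 / 4 * M ^ 2) ^ n * W := by
        rw [mul_inv]
        generalize (1 - s ^ 2 * ρ + s ^ 4 / 4 * M ^ 2) ^ n = κ
        have := hR.ne'
        generalize ρ - s ^ 2 * M ^ 2 / 4 = R at this
        field_simp
      have e3 : (1 - s ^ 2 * ρ + s ^ 4 / 4 * M ^ 2)
          = 1 - s ^ 2 * (ρ - s ^ 2 * M ^ 2 / 4) := by ring
      rw [pow_succ _ n, pow_succ _ n]
      have := hstep n
      set η := (1 - s ^ 2 * ρ / 4) ^ n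
      set κ := (1 - s ^ 2 * ρ + s ^ 4 / 4 * M ^ 2) ^ n
      rw [e3]
      linear_combination ih + this - e1 - e2
  set m := ∫ x, ‖x‖ ∂μ with hm
  have im : Integrable (fun x => ‖x‖) μ := integrable_norm_of_sq continuous_id hμ.integrable_sq
  have ig : ∀ n, Integrable (fun x => (N.step b s)^[n] g x) μ := fun n =>
    integrable_of_continuous_of_abs_le (hreg n).differentiable.continuous
      fun x => abs_le_max_abs_abs (N.iterate_step_mem_Icc hgm b s n x).1
        (N.iterate_step_mem_Icc hgm b s n x).2
  have hmean : ∫ x, g x ∂μ ∈ Set.Icc m₀ m₁ := by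
    constructor
    · simpa using integral_mono (integrable_const m₀) (ig 0) fun x => (hgm x).1
    · simpa using integral_mono (ig 0) (integrable_const m₁) fun x => (hgm x).2
  have herg : ∀ n, ∫ x, Φ ((N.step b s)^[n] g x) ∂μ - Φ (∫ x, g x ∂μ)
      ≤ C * (s * (4 * B * K * C₁ / ρ)) + C * (2 * K * m) * (1 - s ^ 2 * ρ / 4) ^ n := fun n => by
    set gn := (N.step b s)^[n] g with hgn
    set η := (1 - s ^ 2 * ρ / 4) ^ n with hηn
    have hη0 : 0 ≤ η := pow_nonneg hη n
    have mgn : ∀ x, gn x ∈ Set.Icc m₀ m₁ := N.iterate_step_mem_Icc hgm b s n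
    have h0 : |∫ x, gn x ∂μ - gn 0| ≤ η * K * m := by
      have e : ∫ x, gn x ∂μ - gn 0 = ∫ x, (gn x - gn 0) ∂μ := by
        rw [integral_sub (ig n) (integrable_const _), integral_const, probReal_univ, one_smul]
      rw [e, hm, ← integral_const_mul, ← Real.norm_eq_abs]
      refine norm_integral_le_of_norm_le (im.const_mul _) (Filter.Eventually.of_forall fun x => ?_)
      simpa using (hreg n).abs_sub_le x 0
    have h1 : |∫ x, gn x ∂μ - ∫ x, g x ∂μ| ≤ s * (4 * B * K * C₁ / ρ) := by
      refine (hinv n).trans (mul_le_of_le_one_right (by positivity) ?_)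
      linarith
    have h2 : ∀ x, Φ (gn x) ≤ Φ (∫ x, g x ∂μ)
        + C * (η * K * ‖x‖ + η * K * m + s * (4 * B * K * C₁ / ρ)) := fun x => by
      have h3 := hΦ.sub_le hmean (mgn x)
      have h4 : |gn x - gn 0| ≤ η * K * ‖x‖ := by simpa using (hreg n).abs_sub_le x 0
      have h5 : |gn x - ∫ x, g x ∂μ| ≤ η * K * ‖x‖ + η * K * m + s * (4 * B * K * C₁ / ρ) := by
        rw [abs_le] at h0 h1 h4 ⊢
        constructor <;> linarith
      nlinarith [mul_le_mul_of_nonneg_left h5 hC]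
    have iΦ : Integrable (fun x => Φ (gn x)) μ := by
      refine integrable_of_continuous_of_abs_le ?_ fun x => hΦ.abs_le _ (mgn x)
      exact continuous_iff_continuousAt.2 fun x => ContinuousAt.comp (g := Φ)
        (hΦ.hasDerivAt _ (mgn x)).continuousAt (hreg n).differentiable.continuous.continuousAt
    have i2 : Integrable (fun x => η * K * ‖x‖ + η * K * m + s * (4 * B * K * C₁ / ρ)) μ :=
      ((im.const_mul _).add (integrable_const _)).add (integrable_const _)
    have h6 := integral_mono iΦ ((integrable_const _).add (i2.const_mul C)) h2
    have e6 : ∫ x, (Φ (∫ x, g x ∂μ)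
        + C * (η * K * ‖x‖ + η * K * m + s * (4 * B * K * C₁ / ρ))) ∂μ
        = Φ (∫ x, g x ∂μ) + C * (η * K * m + η * K * m + s * (4 * B * K * C₁ / ρ)) := by
      have i3 : Integrable (fun x : E => η * K * ‖x‖ + η * K * m) μ :=
        (im.const_mul _).add (integrable_const _)
      rw [integral_add (integrable_const _) (i2.const_mul C), integral_const_mul,
        integral_add i3 (integrable_const _),
        integral_add (im.const_mul _) (integrable_const _), integral_const_mul]
      simp only [integral_const, probReal_univ, one_smul, hm]
    have h7 := h6.trans_eq e6
    linarith
  have hlim : Filter.Tendsto (fun n : ℕ => s * (4 * E₁ / ρ)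
      + (2 * (ρ - s ^ 2 * M ^ 2 / 4))⁻¹ * W + C * (s * (4 * B * K * C₁ / ρ))
        + C * (2 * K * m) * (1 - s ^ 2 * ρ / 4) ^ n) Filter.atTop
      (nhds (s * (4 * E₁ / ρ)
      + (2 * (ρ - s ^ 2 * M ^ 2 / 4))⁻¹ * W + C * (s * (4 * B * K * C₁ / ρ))
        + C * (2 * K * m) * 0)) :=
    ((tendsto_pow_atTop_nhds_zero_of_lt_one hη hη1).const_mul _).const_add _
  have hall : ∫ x, Φ (g x) ∂μ - Φ (∫ x, g x ∂μ) ≤ _ := ge_of_tendsto' hlim fun n => by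
    have h1 := htel n
    have h2 := herg n
    have h3 : s * (4 * E₁ / ρ) * (1 - (1 - s ^ 2 * ρ / 4) ^ n) ≤ s * (4 * E₁ / ρ) :=
      mul_le_of_le_one_right (by positivity) (by linarith [pow_nonneg hη n])
    have h4 : (2 * (ρ - s ^ 2 * M ^ 2 / 4))⁻¹ * W
          * (1 - (1 - s ^ 2 * ρ + s ^ 4 / 4 * M ^ 2) ^ n)
          ≤ (2 * (ρ - s ^ 2 * M ^ 2 / 4))⁻¹ * W :=
      mul_le_of_le_one_right (by positivity) (by linarith [pow_nonneg hκ n])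
    linarith
  linarith

/-- **Entropy inequality** for the stationary measure of a strongly monotone regular drift. -/
theorem IsLangevinStationary.entropy_le (hμ : IsLangevinStationary μ b)
    (hb : IsRegularDrift ρ M A b) (hρ : 0 < ρ) (hA : 0 ≤ A)
    (N : IsotropicNoise ι E) (hΦ : IsEntropy m₀ m₁ C Φ Φ' Φ'') {K' L' : ℝ}
    (hg : IsC11 K K' g) (hgm : ∀ x, g x ∈ Set.Icc m₀ m₁)
    (hΓ : IsC11 L L' (fun x => Φ'' (g x) * ‖fderiv ℝ g x‖ ^ 2)) :
    ∫ x, Φ (g x) ∂μ - Φ (∫ x, g x ∂μ)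
      ≤ (2 * ρ)⁻¹ * ∫ x, Φ'' (g x) * ‖fderiv ℝ g x‖ ^ 2 ∂μ := by
  have hb' : IsRegularDrift ρ (max M ρ) A b := ⟨hb.differentiable, hb.mono,
    fun x y => (hb.lip x y).trans (by gcongr; exact le_max_left _ _), hb.fderiv_lip⟩
  set M' := max M ρ
  have hM' : ρ ≤ M' := le_max_right _ _
  set B := 4 * A / ρ + 1 with hBdef
  have hB1 : 1 ≤ B := by rw [hBdef]; linarith [show 0 ≤ 4 * A / ρ by positivity]
  have hB : 4 * A ≤ ρ * B := by
    rw [hBdef, mul_add, mul_div_cancel₀ _ hρ.ne']; linarith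
  have hC : 0 ≤ C := (hΦ.deriv2_mem _ (hgm 0)).1.trans (hΦ.deriv2_mem _ (hgm 0)).2
  have key : ∀ {K L : ℝ} {u : E → ℝ}, IsC11 K L u → IsC11 (max K L) (B * max K L) u :=
    fun {K L u} hu => hu.mono (le_max_left _ _) ((le_max_right K L).trans
      (le_mul_of_one_le_left (hu.nonneg.trans (le_max_left _ _)) hB1))
  have hΓm : ∀ x, Φ'' (g x) * ‖fderiv ℝ g x‖ ^ 2 ∈ Set.Icc 0 (C * K ^ 2) := fun x => by
    have h := hΦ.deriv2_mem _ (hgm x)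
    refine ⟨mul_nonneg h.1 (sq_nonneg _), ?_⟩
    gcongr
    exacts [h.2, hg.norm_le x]
  have hev : ∀ᶠ s in nhdsWithin (0 : ℝ) (Set.Ioi 0), IsSmallStep ρ M' s := by
    have h1 : ∀ᶠ s in nhdsWithin (0 : ℝ) (Set.Ioi 0), s < 1 :=
      nhdsWithin_le_nhds (eventually_lt_nhds one_pos)
    have h2 : ∀ᶠ s in nhdsWithin (0 : ℝ) (Set.Ioi 0), s ^ 2 * ρ < 2 := nhdsWithin_le_nhds <|
      (show Continuous fun s : ℝ => s ^ 2 * ρ by fun_prop).tendsto 0 |>.eventually_lt_const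
        (by norm_num)
    have h3 : ∀ᶠ s in nhdsWithin (0 : ℝ) (Set.Ioi 0), s ^ 2 * M' ^ 2 < 2 * ρ :=
      nhdsWithin_le_nhds <|
      (show Continuous fun s : ℝ => s ^ 2 * M' ^ 2 by fun_prop).tendsto 0 |>.eventually_lt_const
        (by simpa using hρ)
    filter_upwards [h1, h2, h3, self_mem_nhdsWithin] with s h1 h2 h3 h4
    exact ⟨h4, h1.le, h2.le, h3.le, pow_le_pow_left₀ hρ.le hM' 2⟩
  have hall := hev.mono fun s hs =>
    hμ.entropy_le_add hb' hρ hA N hΦ hs hB hB1 (key hg) hgm (key hΓ) hΓm rfl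
  refine ge_of_tendsto (x := nhdsWithin (0 : ℝ) (Set.Ioi 0)) ?_ hall
  refine Filter.Tendsto.mono_left ?_ nhdsWithin_le_nhds
  set a₁ := 4 * (B * (C * (1 + max K K') * max K K') * (∫ x, ‖b x‖ ^ 2 ∂μ
    + (N.r + N.r ^ 3) * ∫ x, ‖b x‖ ∂μ) + C * N.r ^ 3 * (B * max K K' + max K K' ^ 2) * max K K') / ρ
    + C * (4 * B * max K K' * (∫ x, ‖b x‖ ^ 2 ∂μ + (N.r + N.r ^ 3) * ∫ x, ‖b x‖ ∂μ) / ρ)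
  set a₂ := 4 * B * max L L' * (∫ x, ‖b x‖ ^ 2 ∂μ + (N.r + N.r ^ 3) * ∫ x, ‖b x‖ ∂μ) / ρ
    + max L L' * ∫ x, ‖b x‖ ∂μ
  set I := ∫ x, Φ'' (g x) * ‖fderiv ℝ g x‖ ^ 2 ∂μ
  have hc : ContinuousAt (fun s : ℝ => s * a₁ + (2 * (ρ - s ^ 2 * M' ^ 2 / 4))⁻¹ * (I + s * a₂))
      0 := by
    refine ContinuousAt.add (by fun_prop) (ContinuousAt.mul (ContinuousAt.inv₀ (by fun_prop) ?_)
      (by fun_prop))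
    simpa using hρ.ne'
  have := hc.tendsto
  simpa using this

end Iterate

section Power

lemma exists_abs_const_mul_rpow_le {m₀ : ℝ} (hm₀ : 0 < m₀) (m₁ c e : ℝ) :
    ∃ C, 0 ≤ C ∧ ∀ x ∈ Set.Icc m₀ m₁, |c * x ^ e| ≤ C := by
  have hc : ContinuousOn (fun x : ℝ => c * x ^ e) (Set.Icc m₀ m₁) := fun x hx =>
    ((Real.continuousAt_rpow_const x e (Or.inl (hm₀.trans_le hx.1).ne')).const_mul
      c).continuousWithinAt
  obtain ⟨C, hC⟩ := isCompact_Icc.exists_bound_of_continuousOn hc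
  exact ⟨|C|, abs_nonneg _, fun x hx => (hC x hx).trans (le_abs_self C)⟩

/-- A function whose derivative is bounded by `D * |z - x| ^ n` on `[m₀, m₁]`. -/
lemma abs_sub_le_of_abs_deriv_le {m₀ m₁ D x y : ℝ} {n : ℕ} {F F' : ℝ → ℝ} (hD : 0 ≤ D)
    (hF : ∀ z ∈ Set.Icc m₀ m₁, HasDerivAt F (F' z) z)
    (hF' : ∀ z ∈ Set.Icc m₀ m₁, |F' z| ≤ D * |z - x| ^ n)
    (hx : x ∈ Set.Icc m₀ m₁) (hy : y ∈ Set.Icc m₀ m₁) :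
    |F y - F x| ≤ D * |y - x| ^ (n + 1) := by
  have hsub : Set.uIcc x y ⊆ Set.Icc m₀ m₁ := Set.uIcc_subset_Icc hx hy
  have := Convex.norm_image_sub_le_of_norm_hasDerivWithin_le (f := F) (f' := F')
    (s := Set.uIcc x y) (C := D * |y - x| ^ n) (x := x) (y := y)
    (fun z hz => (hF z (hsub hz)).hasDerivWithinAt) (fun z hz => (hF' z (hsub hz)).trans (by
      have : |z - x| ≤ |y - x| := by
        rw [abs_sub_comm z x, abs_sub_comm y x]
        simpa [abs_sub_comm] using Set.abs_sub_left_of_mem_uIcc hz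
      gcongr)) (convex_uIcc x y) Set.left_mem_uIcc Set.right_mem_uIcc
  simpa [pow_succ, mul_assoc] using this

lemma rpow_jensen {ι : Type*} [Fintype ι] {p : ℝ} (hp1 : 1 ≤ p) (hp2 : p ≤ 2) (w x y : ι → ℝ)
    (hw : ∀ i, 0 ≤ w i) (hw1 : ∑ i, w i = 1) (hx : ∀ i, 0 < x i) (hpos : 0 < ∑ i, w i * x i) :
    (∑ i, w i * x i) ^ (p - 2) * (∑ i, w i * y i) ^ 2 ≤ ∑ i, w i * (x i ^ (p - 2) * y i ^ 2) := by
  have h1 : ∑ i, w i * x i ^ (2 - p) ≤ (∑ i, w i * x i) ^ (2 - p) := by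
    have := (Real.concaveOn_rpow (p := 2 - p) (by linarith) (by linarith)).le_map_sum
      (t := Finset.univ) (w := w) (p := x) (fun i _ => hw i) hw1 (fun i _ => (hx i).le)
    simpa using this
  have h2 : (∑ i, w i * y i) ^ 2
      ≤ (∑ i, w i * (x i ^ (p - 2) * y i ^ 2)) * ∑ i, w i * x i ^ (2 - p) := by
    refine Finset.sum_sq_le_sum_mul_sum_of_sq_le_mul _ (fun i _ => ?_) (fun i _ => ?_)
      fun i _ => ?_
    · have := Real.rpow_nonneg (hx i).le (p - 2)
      have := hw i
      positivity
    · have := Real.rpow_nonneg (hx i).le (2 - p)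
      have := hw i
      positivity
    · have e : x i ^ (p - 2) * x i ^ (2 - p) = 1 := by
        rw [← Real.rpow_add (hx i)]; simp
      refine le_of_eq ?_
      linear_combination -(w i * y i) ^ 2 * e
  have h3 : 0 ≤ ∑ i, w i * (x i ^ (p - 2) * y i ^ 2) := Finset.sum_nonneg fun i _ => by
    have := Real.rpow_nonneg (hx i).le (p - 2)
    have := hw i
    positivity
  have e : (∑ i, w i * x i) ^ (p - 2) * (∑ i, w i * x i) ^ (2 - p) = 1 := by
    rw [← Real.rpow_add hpos]; simp
  have h4 := Real.rpow_nonneg hpos.le (p - 2)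
  calc _ ≤ (∑ i, w i * x i) ^ (p - 2) * ((∑ i, w i * (x i ^ (p - 2) * y i ^ 2))
        * (∑ i, w i * x i) ^ (2 - p)) := by
        gcongr
        exact h2.trans (by gcongr)
    _ = _ := by linear_combination (∑ i, w i * (x i ^ (p - 2) * y i ^ 2)) * e

/-- Powers with exponent in `[1, 2]` are admissible entropies. -/
lemma exists_isEntropy_rpow {m₀ p : ℝ} (hm₀ : 0 < m₀) (m₁ : ℝ) (hp1 : 1 ≤ p) (hp2 : p ≤ 2) :
    ∃ C, IsEntropy m₀ m₁ C (fun x => x ^ p) (fun x => p * x ^ (p - 1))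
      (fun x => p * (p - 1) * x ^ (p - 2)) := by
  obtain ⟨C₀, h0, hC₀⟩ := exists_abs_const_mul_rpow_le hm₀ m₁ 1 p
  obtain ⟨C₁, h1, hC₁⟩ := exists_abs_const_mul_rpow_le hm₀ m₁ p (p - 1)
  obtain ⟨C₂, h2, hC₂⟩ := exists_abs_const_mul_rpow_le hm₀ m₁ (p * (p - 1)) (p - 2)
  obtain ⟨C₃, h3, hC₃⟩ := exists_abs_const_mul_rpow_le hm₀ m₁ (p * (p - 1) * (p - 2)) (p - 3)
  have hpos : ∀ x ∈ Set.Icc m₀ m₁, 0 < x := fun x hx => hm₀.trans_le hx.1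
  have hd : ∀ (c e : ℝ), ∀ x ∈ Set.Icc m₀ m₁,
      HasDerivAt (fun x : ℝ => c * x ^ e) (c * e * x ^ (e - 1)) x := fun c e x hx => by
    have := (Real.hasDerivAt_rpow_const (x := x) (p := e) (Or.inl (hpos x hx).ne')).const_mul c
    rwa [← mul_assoc] at this
  have hd0 : ∀ x ∈ Set.Icc m₀ m₁, HasDerivAt (fun x : ℝ => x ^ p) (p * x ^ (p - 1)) x :=
    fun x hx => by simpa using hd 1 p x hx
  have hd1 : ∀ x ∈ Set.Icc m₀ m₁,
      HasDerivAt (fun x : ℝ => p * x ^ (p - 1)) (p * (p - 1) * x ^ (p - 2)) x := fun x hx => by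
    have := hd p (p - 1) x hx
    rwa [show p - 1 - 1 = p - 2 by ring] at this
  have hd2 : ∀ x ∈ Set.Icc m₀ m₁, HasDerivAt (fun x : ℝ => p * (p - 1) * x ^ (p - 2))
      (p * (p - 1) * (p - 2) * x ^ (p - 3)) x := fun x hx => by
    have := hd (p * (p - 1)) (p - 2) x hx
    rwa [show p - 2 - 1 = p - 3 by ring] at this
  have hl1 : ∀ x ∈ Set.Icc m₀ m₁, ∀ y ∈ Set.Icc m₀ m₁,
      |p * y ^ (p - 1) - p * x ^ (p - 1)| ≤ C₂ * |y - x| := fun x hx y hy => by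
    have := abs_sub_le_of_abs_deriv_le (n := 0) (x := x) h2 hd1 (by simpa using hC₂) hx hy
    simpa using this
  have hl2 : ∀ x ∈ Set.Icc m₀ m₁, ∀ y ∈ Set.Icc m₀ m₁,
      |p * (p - 1) * y ^ (p - 2) - p * (p - 1) * x ^ (p - 2)| ≤ C₃ * |y - x| :=
    fun x hx y hy => by
    have := abs_sub_le_of_abs_deriv_le (n := 0) (x := x) h3 hd2 (by simpa using hC₃) hx hy
    simpa using this
  have ht1 : ∀ x ∈ Set.Icc m₀ m₁, ∀ y ∈ Set.Icc m₀ m₁,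
      |p * y ^ (p - 1) - p * x ^ (p - 1) - p * (p - 1) * x ^ (p - 2) * (y - x)|
        ≤ C₃ * |y - x| ^ 2 := fun x hx y hy => by
    have := abs_sub_le_of_abs_deriv_le (n := 1) (x := x) h3
      (F := fun y => p * y ^ (p - 1) - p * (p - 1) * x ^ (p - 2) * y)
      (fun z hz => (hd1 z hz).sub ((hasDerivAt_id z).const_mul (p * (p - 1) * x ^ (p - 2))))
      (fun z hz => by simpa using hl2 x hx z hz) hx hy
    convert this using 2
    ring
  have ht2 : ∀ x ∈ Set.Icc m₀ m₁, ∀ y ∈ Set.Icc m₀ m₁,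
      |y ^ p - x ^ p - p * x ^ (p - 1) * (y - x) - p * (p - 1) * x ^ (p - 2) / 2 * (y - x) ^ 2|
        ≤ C₃ * |y - x| ^ 3 := fun x hx y hy => by
    have := abs_sub_le_of_abs_deriv_le (n := 2) (x := x) h3
      (F := fun y => y ^ p - p * x ^ (p - 1) * y - p * (p - 1) * x ^ (p - 2) / 2 * (y - x) ^ 2)
      (fun z hz => ((hd0 z hz).sub ((hasDerivAt_id z).const_mul (p * x ^ (p - 1)))).sub
        ((((hasDerivAt_id z).sub_const x).pow 2).const_mul (p * (p - 1) * x ^ (p - 2) / 2)))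
      (fun z hz => by
        convert ht1 x hx z hz using 2
        simp
        ring) hx hy
    convert this using 2
    ring
  refine ⟨C₀ + C₁ + C₂ + C₃, hd0, fun x hx => ?_, fun x hx => ?_, fun x hx y hy => ?_,
    fun x hx => ⟨?_, ?_⟩, fun x hx y hy => ?_, fun x hx y hy => ?_, ?_⟩
  · have := hC₀ x hx
    rw [one_mul] at this
    linarith
  · linarith [hC₁ x hx]
  · refine (hl1 y hy x hx).trans ?_
    gcongr
    linarith
  · exact mul_nonneg (mul_nonneg (by linarith) (by linarith)) (Real.rpow_nonneg (hpos x hx).le _)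
  · linarith [hC₂ x hx, le_abs_self (p * (p - 1) * x ^ (p - 2))]
  · have hx0 := hpos x hx
    have hy0 := hpos y hy
    have hB := one_add_mul_self_le_rpow_one_add (s := y / x - 1) (p := p)
      (by linarith [show 0 ≤ y / x by positivity]) hp1
    rw [add_sub_cancel, Real.div_rpow hy0.le hx0.le, le_div_iff₀ (by positivity)] at hB
    have e : x ^ p = x ^ (p - 1) * x := by
      rw [← Real.rpow_add_one hx0.ne']; simp
    refine le_trans (le_of_eq ?_) hB
    rw [e]
    field_simp
  · have := (abs_le.1 (ht2 x hx y hy)).2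
    have h4 : C₃ * |y - x| ^ 3 ≤ (C₀ + C₁ + C₂ + C₃) * |y - x| ^ 3 := by
      gcongr
      linarith
    linarith
  · intro ι _ w x y hw hw1 hx hy
    have hp : 0 < ∑ i, w i * x i := by
      calc 0 < m₀ := hm₀
        _ = ∑ i, w i * m₀ := by rw [← Finset.sum_mul, hw1, one_mul]
        _ ≤ _ := Finset.sum_le_sum fun i _ => mul_le_mul_of_nonneg_left (hx i).1 (hw i)
    have := rpow_jensen hp1 hp2 w x y hw hw1 (fun i => hpos _ (hx i)) hp
    have hc : 0 ≤ p * (p - 1) := mul_nonneg (by linarith) (by linarith)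
    calc _ = p * (p - 1) * ((∑ i, w i * x i) ^ (p - 2) * (∑ i, w i * y i) ^ 2) := by ring
      _ ≤ p * (p - 1) * ∑ i, w i * (x i ^ (p - 2) * y i ^ 2) := by gcongr
      _ = _ := by
        rw [Finset.mul_sum]
        exact Finset.sum_congr rfl fun i _ => by ring

end Power

/-- The Rademacher-type isotropic noise on Euclidean space. -/
lemma exists_isotropicNoise (d : ℕ) : ∃ (ι : Type) (_ : Fintype ι),
    Nonempty (IsotropicNoise ι (EuclideanSpace ℝ (Fin d))) := by
  rcases Nat.eq_zero_or_pos d with rfl | hd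
  · refine ⟨Unit, inferInstance, ⟨fun _ => 1, fun _ => 0, 0, ?_, ?_, ?_, ?_, ?_, ?_⟩⟩
    · simp
    · simp
    · simp
    · intro x y
      simp [Subsingleton.elim x 0]
    · simp
    · simp
  · have hd0 : (d : ℝ) ≠ 0 := by positivity
    let e : Fin d → EuclideanSpace ℝ (Fin d) := fun i => EuclideanSpace.single i 1
    refine ⟨Fin d × Bool, inferInstance, ⟨fun _ => 1 / (2 * d),
      fun i => (if i.2 then √d else -√d) • e i.1, √d, ?_, ?_, ?_, ?_, ?_, ?_⟩⟩
    · intro i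
      positivity
    · simp
      field_simp
    · rw [Fintype.sum_prod_type]
      simp
    · intro x y
      rw [Fintype.sum_prod_type]
      simp only [Fintype.sum_bool, inner_smul_right, e, PiLp.inner_apply, if_true, Bool.false_eq_true,
        if_false]
      refine Finset.sum_congr rfl fun i _ => ?_
      have hs : √(d : ℝ) * √d = d := Real.mul_self_sqrt (by positivity)
      have h1 : ∀ z : EuclideanSpace ℝ (Fin d),
          ∑ j, inner ℝ (z j) ((EuclideanSpace.single i (1 : ℝ) : EuclideanSpace ℝ (Fin d)) j)
            = z i := fun z => by
        simp
      rw [h1, h1]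
      simp
      field_simp
      linear_combination (2 * x i * y i) * hs
    · intro i
      rw [norm_smul]
      have : ‖(if i.2 then √(d : ℝ) else -√d)‖ = √d := by
        split <;> simp
      rw [this]
      simp [e]
    · exact Real.sqrt_nonneg _

lemma one_add_pow_mul_exp_neg_le {α t : ℝ} (hα : 0 < α) (ht : 0 ≤ t) (n : ℕ) :
    (1 + t) ^ (2 * n) * Real.exp (-(α * t ^ 2)) ≤ 2 ^ n * Real.exp α * n.factorial / α ^ n := by
  have h1 : (1 + t) ^ (2 * n) ≤ 2 ^ n * (1 + t ^ 2) ^ n := by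
    rw [pow_mul, ← mul_pow]
    gcongr
    nlinarith [sq_nonneg (1 - t)]
  have h2 := Real.pow_div_factorial_le_exp (α * (1 + t ^ 2)) (by positivity) n
  rw [div_le_iff₀ (by positivity), mul_pow] at h2
  rw [le_div_iff₀ (by positivity)]
  calc (1 + t) ^ (2 * n) * Real.exp (-(α * t ^ 2)) * α ^ n
      ≤ 2 ^ n * (1 + t ^ 2) ^ n * Real.exp (-(α * t ^ 2)) * α ^ n := by gcongr
    _ = 2 ^ n * Real.exp (-(α * t ^ 2)) * (α ^ n * (1 + t ^ 2) ^ n) := by ring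
    _ ≤ 2 ^ n * Real.exp (-(α * t ^ 2)) * (Real.exp (α * (1 + t ^ 2)) * n.factorial) := by gcongr
    _ = 2 ^ n * (Real.exp (-(α * t ^ 2)) * Real.exp (α * (1 + t ^ 2))) * n.factorial := by ring
    _ = 2 ^ n * Real.exp α * n.factorial := by rw [← Real.exp_add]; ring_nf

section Gibbs

variable {E : Type*} [NormedAddCommGroup E] [InnerProductSpace ℝ E]
  [FiniteDimensional ℝ E] [MeasurableSpace E] [BorelSpace E] {ν : Measure E}
  [ν.IsAddHaarMeasure] {α c ρ M A : ℝ} {H : E → ℝ} {b : E → E}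

lemma integrable_one_add_norm_sq_mul_exp_neg (hα : 0 < α) (hHc : Continuous H)
    (hH : ∀ x, α * ‖x‖ ^ 2 - c ≤ H x) :
    Integrable (fun x => (1 + ‖x‖) ^ 2 * Real.exp (-H x)) ν := by
  set d := Module.finrank ℝ E with hd
  have hi := (integrable_one_add_norm (E := E) (μ := ν) (r := (2 * (d + 1) : ℕ)) (by
    rw [← hd]; push_cast; linarith [(Nat.cast_nonneg d : (0 : ℝ) ≤ d)])).const_mul
    (Real.exp c * (2 ^ (d + 2) * Real.exp α * (d + 2).factorial / α ^ (d + 2)))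
  refine Integrable.mono' hi (by fun_prop : Continuous _).aestronglyMeasurable
    (Filter.Eventually.of_forall fun x => ?_)
  rw [Real.norm_of_nonneg (by positivity), Real.rpow_neg (by positivity), Real.rpow_natCast,
    ← div_eq_mul_inv, le_div_iff₀ (by positivity)]
  calc (1 + ‖x‖) ^ 2 * Real.exp (-H x) * (1 + ‖x‖) ^ (2 * (d + 1))
      ≤ (1 + ‖x‖) ^ 2 * Real.exp (c + -(α * ‖x‖ ^ 2)) * (1 + ‖x‖) ^ (2 * (d + 1)) := by
        gcongr; linarith [hH x]
    _ = Real.exp c * ((1 + ‖x‖) ^ (2 * (d + 2)) * Real.exp (-(α * ‖x‖ ^ 2))) := by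
        rw [Real.exp_add]; ring
    _ ≤ _ := by gcongr; exact one_add_pow_mul_exp_neg_le hα (norm_nonneg x) _

lemma integrable_mul_exp_neg (hα : 0 < α) (hHc : Continuous H)
    (hH : ∀ x, α * ‖x‖ ^ 2 - c ≤ H x) {u : E → ℝ} {C : ℝ} (hu : Continuous u)
    (h : ∀ x, |u x| ≤ C * (1 + ‖x‖) ^ 2) :
    Integrable (fun x => u x * Real.exp (-H x)) ν := by
  refine Integrable.mono' ((integrable_one_add_norm_sq_mul_exp_neg hα hHc hH).const_mul C)
    (by fun_prop : Continuous _).aestronglyMeasurable (Filter.Eventually.of_forall fun x => ?_)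
  rw [norm_mul, Real.norm_eq_abs, Real.norm_of_nonneg (Real.exp_nonneg _), ← mul_assoc]
  gcongr
  exact h x

lemma integral_gibbs (hHc : Continuous H) (u : E → ℝ) :
    ∫ x, u x ∂(ν.withDensity fun x => ENNReal.ofReal (Real.exp (-H x)))
      = ∫ x, u x * Real.exp (-H x) ∂ν := by
  rw [integral_withDensity_eq_integral_toReal_smul (by fun_prop)
    (Filter.Eventually.of_forall fun x => ENNReal.ofReal_lt_top)]
  refine integral_congr_ae (Filter.Eventually.of_forall fun x => ?_)
  simp only [smul_eq_mul, ENNReal.toReal_ofReal (Real.exp_nonneg _), mul_comm]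

lemma integrable_gibbs_iff (hHc : Continuous H) (u : E → ℝ) :
    Integrable u (ν.withDensity fun x => ENNReal.ofReal (Real.exp (-H x)))
      ↔ Integrable (fun x => u x * Real.exp (-H x)) ν := by
  rw [integrable_withDensity_iff_integrable_smul' (by fun_prop)
    (Filter.Eventually.of_forall fun x => ENNReal.ofReal_lt_top)]
  simp only [smul_eq_mul, ENNReal.toReal_ofReal (Real.exp_nonneg _), mul_comm]

/-- A Gibbs measure with strongly confining potential satisfies integration by parts. -/
lemma isLangevinStationary_gibbs (hα : 0 < α) (hH : ∀ x, α * ‖x‖ ^ 2 - c ≤ H x)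
    (hb : IsRegularDrift ρ M A b) (hM : 0 ≤ M)
    (hd : ∀ x, HasFDerivAt H (innerSL ℝ (b x)) x) :
    IsLangevinStationary (ν.withDensity fun x => ENNReal.ofReal (Real.exp (-H x))) b := by
  have hHc : Continuous H := continuous_iff_continuousAt.2 fun x => (hd x).continuousAt
  have hbc := hb.differentiable.continuous
  refine ⟨(integrable_gibbs_iff hHc _).2 (integrable_mul_exp_neg hα hHc hH (C := 1)
    (by fun_prop) fun x => ?_), fun {u K L C} hu hC a => ?_⟩
  · rw [abs_of_nonneg (by positivity)]
    nlinarith [norm_nonneg x]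
  have huc := hu.differentiable.continuous
  have hDc : Continuous fun x => fderiv ℝ u x a := hu.continuous_fderiv.clm_apply continuous_const
  rw [integral_gibbs hHc, integral_gibbs hHc]
  have hde : ∀ x, HasFDerivAt (fun x => Real.exp (-H x))
      (Real.exp (-H x) • -(innerSL ℝ (b x))) x := fun x => (hd x).neg.exp
  have hdv : ∀ x, fderiv ℝ (fun x => Real.exp (-H x)) x a
      = -(Real.exp (-H x) * inner ℝ (b x) a) := fun x => by
    rw [(hde x).fderiv]; simp
  have hC0 : 0 ≤ C := (abs_nonneg _).trans (hC 0)
  have hone : ∀ x : E, 1 ≤ (1 + ‖x‖) ^ 2 := fun x => by nlinarith [norm_nonneg x]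
  have key := integral_mul_fderiv_eq_neg_fderiv_mul_of_integrable (𝕜 := ℝ) (μ := ν) (f := u)
    (g := fun x => Real.exp (-H x)) (v := a) ?_ ?_ ?_
    (fun x _ => hu.differentiable x) (fun x _ => (hde x).differentiableAt)
  · simp only [hdv] at key
    rw [← neg_eq_iff_eq_neg, ← integral_neg] at key
    rw [← key]
    refine integral_congr_ae (Filter.Eventually.of_forall fun x => ?_)
    simp only
    ring
  · refine integrable_mul_exp_neg hα hHc hH (C := K * ‖a‖) hDc fun x => ?_
    calc |fderiv ℝ u x a| ≤ ‖fderiv ℝ u x‖ * ‖a‖ := (fderiv ℝ u x).le_opNorm a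
      _ ≤ K * ‖a‖ := by gcongr; exact hu.norm_le x
      _ ≤ _ := le_mul_of_one_le_right (mul_nonneg hu.nonneg (norm_nonneg _)) (hone x)
  · simp only [hdv]
    have := integrable_mul_exp_neg (ν := ν) hα hHc hH (u := fun x => -(u x * inner ℝ (b x) a))
      (C := C * ((‖b 0‖ + M) * ‖a‖)) (by fun_prop) fun x => ?_
    · exact this.congr (Filter.Eventually.of_forall fun x => by simp only; ring)
    · rw [abs_neg, abs_mul]
      calc |u x| * |inner ℝ (b x) a| ≤ C * (((‖b 0‖ + M) * (1 + ‖x‖) ^ 2) * ‖a‖) := by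
            gcongr
            · exact hC x
            · refine (abs_real_inner_le_norm _ _).trans ?_
              gcongr
              refine (hb.norm_le x).trans ?_
              have h1 : ‖x‖ ≤ (1 + ‖x‖) ^ 2 := by nlinarith [norm_nonneg x]
              nlinarith [hone x, norm_nonneg (b 0)]
        _ = _ := by ring
  · exact integrable_mul_exp_neg hα hHc hH (C := C) huc fun x =>
      (hC x).trans (le_mul_of_one_le_right hC0 (hone x))

end Gibbs

section Mollify

variable {E F : Type*} [NormedAddCommGroup E] [InnerProductSpace ℝ E]
  [FiniteDimensional ℝ E] [MeasurableSpace E] [BorelSpace E] {ν : Measure E}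
  [ν.IsAddHaarMeasure] [NormedAddCommGroup F] [NormedSpace ℝ F] {f : E → ℝ} {ℓ : ℝ}

/-- The convolution of a scalar function `f` with a vector valued kernel `ψ`. -/
noncomputable def mollify (ν : Measure E) (f : E → ℝ) (ψ : E → F) (x : E) : F :=
  ∫ t, f (x - t) • ψ t ∂ν

lemma continuous_of_abs_sub_le (hf : ∀ x y, |f x - f y| ≤ ℓ * ‖x - y‖) : Continuous f := by
  have : LipschitzWith (Real.toNNReal ℓ) f := by
    refine LipschitzWith.of_dist_le_mul fun x y => ?_
    rw [dist_eq_norm, dist_eq_norm]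
    refine (hf x y).trans ?_
    gcongr
    exact Real.le_coe_toNNReal ℓ
  exact this.continuous

lemma integrable_mollify (hf : Continuous f) {ψ : E → F} (hψ : Continuous ψ)
    (hc : HasCompactSupport ψ) (x : E) : Integrable (fun t => f (x - t) • ψ t) ν :=
  ((hf.comp (continuous_const.sub continuous_id)).smul hψ).integrable_of_hasCompactSupport
    hc.smul_left

lemma norm_mollify_sub_le (hf : ∀ x y, |f x - f y| ≤ ℓ * ‖x - y‖) {ψ : E → F} (hψ : Continuous ψ)
    (hc : HasCompactSupport ψ) (x y : E) :
    ‖mollify ν f ψ x - mollify ν f ψ y‖ ≤ (ℓ * ∫ t, ‖ψ t‖ ∂ν) * ‖x - y‖ := by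
  have hfc := continuous_of_abs_sub_le hf
  rw [mollify, mollify, ← integral_sub (integrable_mollify hfc hψ hc x)
    (integrable_mollify hfc hψ hc y)]
  calc _ ≤ ∫ t, ℓ * ‖x - y‖ * ‖ψ t‖ ∂ν := by
        refine norm_integral_le_of_norm_le
          ((hψ.integrable_of_hasCompactSupport hc).norm.const_mul _)
          (Filter.Eventually.of_forall fun t => ?_)
        rw [← sub_smul, norm_smul]
        gcongr
        simpa using hf (x - t) (y - t)
    _ = _ := by rw [integral_const_mul]; ring

lemma hasFDerivAt_mollify [CompleteSpace F] (hf : Continuous f) {ψ : E → F} (hψ : ContDiff ℝ 1 ψ)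
    (hc : HasCompactSupport ψ) (x : E) :
    HasFDerivAt (mollify ν f ψ) (mollify ν f (fderiv ℝ ψ) x) x :=
  hc.hasFDerivAt_convolution_left (ContinuousLinearMap.lsmul ℝ ℝ (E := F)).flip hψ
    (hf.locallyIntegrable (μ := ν)) x

lemma convexOn_mollify (hf : Continuous f) (hcf : ConvexOn ℝ Set.univ f) {ψ : E → ℝ}
    (hψ : Continuous ψ) (hc : HasCompactSupport ψ) (h0 : ∀ x, 0 ≤ ψ x) :
    ConvexOn ℝ Set.univ (mollify ν f ψ) := by
  refine ⟨convex_univ, fun x _ y _ a b ha hb hab => ?_⟩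
  have hi := fun x => integrable_mollify (ν := ν) hf hψ hc x
  simp only [mollify]
  rw [← integral_smul, ← integral_smul,
    ← integral_add (f := fun t => a • f (x - t) • ψ t) (g := fun t => b • f (y - t) • ψ t)
      ((hi x).smul a) ((hi y).smul b)]
  refine integral_mono (hi _) (((hi x).smul a).add ((hi y).smul b)) fun t => ?_
  have h := hcf.2 (Set.mem_univ (x - t)) (Set.mem_univ (y - t)) ha hb hab
  have h2 : a • (x - t) + b • (y - t) = a • x + b • y - t := by
    rw [smul_sub, smul_sub, sub_add_sub_comm, ← add_smul, hab, one_smul]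
  rw [h2] at h
  simp only [smul_eq_mul] at h ⊢
  nlinarith [mul_le_mul_of_nonneg_right h (h0 t)]

lemma ConvexOn.fderiv_sub_nonneg {W : E → ℝ} {W' : E → E →L[ℝ] ℝ} (hW : ConvexOn ℝ Set.univ W)
    (hd : ∀ x, HasFDerivAt W (W' x) x) (x y : E) : 0 ≤ (W' x - W' y) (x - y) := by
  have h1 : ∀ t : ℝ, HasDerivAt (fun t : ℝ => W (AffineMap.lineMap y x t))
      (W' (AffineMap.lineMap y x t) (x - y)) t := fun t =>
    (hd _).comp_hasDerivAt t AffineMap.hasDerivAt_lineMap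
  have h2 : ConvexOn ℝ Set.univ (fun t : ℝ => W (AffineMap.lineMap y x t)) :=
    hW.comp_affineMap (AffineMap.lineMap y x)
  have h3 := h2.monotoneOn_deriv (fun t _ => (h1 t).differentiableAt) (Set.mem_univ 0)
    (Set.mem_univ 1) zero_le_one
  rw [(h1 0).deriv, (h1 1).deriv] at h3
  simpa using h3

/-- A smooth mollification of a convex Lipschitz function, plus a quadratic function, has a regular
gradient. -/
lemma isRegularDrift_mollify {ρ : ℝ} (hρ : 0 ≤ ρ) (hf : ∀ x y, |f x - f y| ≤ ℓ * ‖x - y‖)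
    (hℓ : 0 ≤ ℓ) (hcf : ConvexOn ℝ Set.univ f) {ψ : E → ℝ} (hψ : ContDiff ℝ 3 ψ)
    (hc : HasCompactSupport ψ) (h0 : ∀ x, 0 ≤ ψ x) :
    ∃ (b : E → E) (M A : ℝ), IsRegularDrift ρ M A b ∧ 0 ≤ M ∧ 0 ≤ A ∧
      ∀ x, HasFDerivAt (fun x => ρ / 2 * ‖x‖ ^ 2 + mollify ν f ψ x) (innerSL ℝ (b x)) x := by
  have hfc := continuous_of_abs_sub_le hf
  have hψ1 : ContDiff ℝ 2 (fderiv ℝ ψ) := hψ.fderiv_right (by norm_num)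
  have hψ2 : ContDiff ℝ 1 (fderiv ℝ (fderiv ℝ ψ)) := hψ1.fderiv_right (by norm_num)
  have hc1 : HasCompactSupport (fderiv ℝ ψ) := hc.fderiv ℝ
  have hc2 : HasCompactSupport (fderiv ℝ (fderiv ℝ ψ)) := hc1.fderiv ℝ
  set W' := mollify ν f (fderiv ℝ ψ) with hW'
  have hd : ∀ x, HasFDerivAt (mollify ν f ψ) (W' x) x := fun x =>
    hasFDerivAt_mollify hfc (hψ.of_le (by norm_num)) hc x
  have hd1 : ∀ x, HasFDerivAt W' (mollify ν f (fderiv ℝ (fderiv ℝ ψ)) x) x := fun x =>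
    hasFDerivAt_mollify hfc (hψ1.of_le (by norm_num)) hc1 x
  have hconv := convexOn_mollify (ν := ν) hfc hcf hψ.continuous hc h0
  let T : (E →L[ℝ] ℝ) →L[ℝ] E :=
    (InnerProductSpace.toDual ℝ E).symm.toContinuousLinearEquiv.toContinuousLinearMap
  have hT : ∀ φ, ‖T φ‖ = ‖φ‖ := fun φ => (InnerProductSpace.toDual ℝ E).symm.norm_map φ
  have hTi : ∀ φ v, inner ℝ (T φ) v = φ v := fun φ v =>
    InnerProductSpace.toDual_symm_apply
  have hbd : ∀ x, HasFDerivAt (fun x => ρ • x + T (W' x))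
      (ρ • ContinuousLinearMap.id ℝ E + T.comp (mollify ν f (fderiv ℝ (fderiv ℝ ψ)) x)) x :=
    fun x => ((hasFDerivAt_id x).const_smul ρ).add (T.hasFDerivAt.comp x (hd1 x))
  have hA0 : 0 ≤ ℓ * ∫ t, ‖fderiv ℝ (fderiv ℝ ψ) t‖ ∂ν := by positivity
  have hM0 : 0 ≤ ℓ * ∫ t, ‖fderiv ℝ ψ t‖ ∂ν := by positivity
  refine ⟨fun x => ρ • x + T (W' x), ρ + ℓ * ∫ t, ‖fderiv ℝ ψ t‖ ∂ν,
    ℓ * ∫ t, ‖fderiv ℝ (fderiv ℝ ψ) t‖ ∂ν, ⟨fun x => (hbd x).differentiableAt, fun x y => ?_,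
    fun x y => ?_, fun x y => ?_⟩, by positivity, hA0, fun x => ?_⟩
  · have h1 := hconv.fderiv_sub_nonneg hd x y
    have h2 : ρ • x + T (W' x) - (ρ • y + T (W' y)) = ρ • (x - y) + T (W' x - W' y) := by
      rw [map_sub, smul_sub]; abel
    rw [h2, inner_add_left, hTi, inner_smul_left, real_inner_self_eq_norm_sq]
    simpa using h1
  · have h2 : ρ • x + T (W' x) - (ρ • y + T (W' y)) = ρ • (x - y) + T (W' x - W' y) := by
      rw [map_sub, smul_sub]; abel
    rw [h2, add_mul]
    refine (norm_add_le _ _).trans (add_le_add ?_ ?_)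
    · rw [norm_smul, Real.norm_of_nonneg hρ]
    · rw [hT]
      exact norm_mollify_sub_le hf hψ1.continuous hc1 x y
  · rw [(hbd x).fderiv, (hbd y).fderiv, add_sub_add_left_eq_sub, ← ContinuousLinearMap.comp_sub]
    refine le_trans ?_ (norm_mollify_sub_le hf hψ2.continuous hc2 x y)
    refine ContinuousLinearMap.opNorm_le_bound _ (by positivity) fun v => ?_
    rw [ContinuousLinearMap.comp_apply, hT]
    exact ContinuousLinearMap.le_opNorm _ v
  · have h1 : HasFDerivAt (fun x : E => ‖x‖ ^ 2) (2 • innerSL ℝ x) x :=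
      (hasStrictFDerivAt_norm_sq x).hasFDerivAt
    refine ((h1.const_mul (ρ / 2)).add (hd x)).congr_fderiv ?_
    ext v
    simp [hTi]
    ring

end Mollify

section Envelope

variable {E : Type*} [NormedAddCommGroup E] [InnerProductSpace ℝ E]
  [FiniteDimensional ℝ E] {V : E → ℝ} {V' : E → E →L[ℝ] ℝ} {R : ℝ}

/-- The supremum of the tangents to `V` at points of the ball of radius `R`. -/
noncomputable def tangentEnvelope (V : E → ℝ) (V' : E → E →L[ℝ] ℝ) (R : ℝ) (x : E) : ℝ :=
  ⨆ y : Metric.closedBall (0 : E) R, (V y + V' y (x - y))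

lemma le_tangentEnvelope (hV : ∀ x y, V y + V' y (x - y) ≤ V x) (x : E) {y : E} (hy : ‖y‖ ≤ R) :
    V y + V' y (x - y) ≤ tangentEnvelope V V' R x :=
  le_ciSup (f := fun y : Metric.closedBall (0 : E) R => V y + V' y (x - y))
    ⟨V x, by rintro _ ⟨y, rfl⟩; exact hV x y⟩ ⟨y, by simpa using hy⟩

lemma tangentEnvelope_le (hR : 0 ≤ R) {x : E} {a : ℝ} (h : ∀ y, ‖y‖ ≤ R → V y + V' y (x - y) ≤ a) :
    tangentEnvelope V V' R x ≤ a := by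
  have : Nonempty (Metric.closedBall (0 : E) R) := ⟨⟨0, by simpa using hR⟩⟩
  exact ciSup_le fun y => h y (mem_closedBall_zero_iff.1 y.2)

lemma tangentEnvelope_eq (hV : ∀ x y, V y + V' y (x - y) ≤ V x) (hR : 0 ≤ R) {x : E}
    (hx : ‖x‖ ≤ R) : tangentEnvelope V V' R x = V x :=
  le_antisymm (tangentEnvelope_le hR fun y _ => hV x y) (by simpa using le_tangentEnvelope hV x hx)

lemma convexOn_tangentEnvelope (hV : ∀ x y, V y + V' y (x - y) ≤ V x) (hR : 0 ≤ R) :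
    ConvexOn ℝ Set.univ (tangentEnvelope V V' R) := by
  refine ⟨convex_univ, fun x _ z _ a b ha hb hab => tangentEnvelope_le hR fun y hy => ?_⟩
  have h1 := mul_le_mul_of_nonneg_left (le_tangentEnvelope hV x hy) ha
  have h2 := mul_le_mul_of_nonneg_left (le_tangentEnvelope hV z hy) hb
  have h3 : V y + V' y (a • x + b • z - y)
      = a * (V y + V' y (x - y)) + b * (V y + V' y (z - y)) := by
    simp only [map_sub, map_add, map_smul, smul_eq_mul]
    linear_combination (V' y y - V y) * hab
  rw [h3]
  simpa using add_le_add h1 h2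

lemma exists_abs_tangentEnvelope_sub_le (hV : ∀ x y, V y + V' y (x - y) ≤ V x)
    (hc : Continuous V') (hR : 0 ≤ R) :
    ∃ ℓ, 0 ≤ ℓ ∧ ∀ x z, |tangentEnvelope V V' R x - tangentEnvelope V V' R z| ≤ ℓ * ‖x - z‖ := by
  obtain ⟨ℓ, hℓ⟩ := (isCompact_closedBall (0 : E) R).exists_bound_of_continuousOn hc.continuousOn
  have key : ∀ x z, tangentEnvelope V V' R x ≤ tangentEnvelope V V' R z + ℓ * ‖x - z‖ := by
    refine fun x z => tangentEnvelope_le hR fun y hy => ?_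
    have h1 := le_tangentEnvelope hV z hy
    have h2 : V' y (x - z) ≤ ℓ * ‖x - z‖ := by
      refine (le_abs_self _).trans (((V' y).le_opNorm _).trans ?_)
      gcongr
      exact hℓ y (by simpa using hy)
    have h3 : V' y (x - y) = V' y (z - y) + V' y (x - z) := by
      rw [← map_add]; congr 1; abel
    linarith
  refine ⟨ℓ, (norm_nonneg _).trans (hℓ 0 (by simpa using hR)), fun x z => ?_⟩
  rw [abs_le]
  constructor
  · have := key z x
    rw [norm_sub_rev] at this
    linarith
  · linarith [key x z]

/-- A function with strongly monotone gradient is a pointwise limit of functions with regular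
strongly monotone gradient. -/
lemma exists_regular_approx {ρ : ℝ} (hρ : 0 < ρ)
    (hV : ∀ x y, V y + V' y (x - y) ≤ V x) (hVc : Continuous V) (hc : Continuous V') :
    ∃ (H : ℕ → E → ℝ) (c : ℝ), (∀ k, ∃ (b : E → E) (M A : ℝ), IsRegularDrift ρ M A b ∧ 0 ≤ M ∧
      0 ≤ A ∧ ∀ x, HasFDerivAt (H k) (innerSL ℝ (b x)) x) ∧
      (∀ k x, ρ / 4 * ‖x‖ ^ 2 - c ≤ H k x) ∧
      ∀ x, Filter.Tendsto (fun k => H k x) Filter.atTop (nhds (ρ / 2 * ‖x‖ ^ 2 + V x)) := by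
  let : MeasurableSpace E := borel E
  have : BorelSpace E := ⟨rfl⟩
  let ν : Measure E := volume
  let φ : ℕ → ContDiffBump (0 : E) := fun k =>
    ⟨1 / (2 * (k + 1 : ℝ)), 1 / (k + 1 : ℝ), by positivity, by
      apply one_div_lt_one_div_of_lt <;> linarith [(Nat.cast_nonneg k : (0 : ℝ) ≤ k)]⟩
  have hφ1 : ∀ k, (φ k).rOut ≤ 1 := fun k => by
    change 1 / (k + 1 : ℝ) ≤ 1
    rw [div_le_one (by positivity)]
    linarith [(Nat.cast_nonneg k : (0 : ℝ) ≤ k)]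
  have hφ0 : Filter.Tendsto (fun k => (φ k).rOut) Filter.atTop (nhds 0) :=
    tendsto_one_div_add_atTop_nhds_zero_nat
  have hsupp : ∀ k t, 1 < ‖t‖ → (φ k).normed ν t = 0 := fun k t ht => by
    have : t ∉ Function.support ((φ k).normed ν) := by
      rw [(φ k).support_normed_eq]
      simp only [Metric.mem_ball, dist_zero_right, not_lt]
      exact (hφ1 k).trans ht.le
    simpa using this
  let f : ℕ → E → ℝ := fun k => tangentEnvelope V V' k
  have hf : ∀ k, ∃ ℓ, 0 ≤ ℓ ∧ ∀ x z, |f k x - f k z| ≤ ℓ * ‖x - z‖ := fun k =>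
    exists_abs_tangentEnvelope_sub_le hV hc (Nat.cast_nonneg k)
  refine ⟨fun k x => ρ / 2 * ‖x‖ ^ 2 + mollify ν (f k) ((φ k).normed ν) x,
    ‖V' 0‖ ^ 2 / ρ - V 0 + ‖V' 0‖, fun k => ?_, fun k x => ?_, fun x => ?_⟩
  · obtain ⟨ℓ, hℓ, hfl⟩ := hf k
    exact isRegularDrift_mollify hρ.le hfl hℓ (convexOn_tangentEnvelope hV (Nat.cast_nonneg k))
      ((φ k).contDiff_normed (n := 3)) (φ k).hasCompactSupport_normed fun x => (φ k).nonneg_normed x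
  · obtain ⟨ℓ, hℓ, hfl⟩ := hf k
    have h1 : V 0 - ‖V' 0‖ * ‖x‖ - ‖V' 0‖ ≤ mollify ν (f k) ((φ k).normed ν) x := by
      have h2 := (φ k).integral_normed_smul ν (V 0 - ‖V' 0‖ * ‖x‖ - ‖V' 0‖)
      rw [← h2]
      refine integral_mono ((φ k).integrable_normed.smul_const _)
        (integrable_mollify (continuous_of_abs_sub_le hfl) (φ k).continuous_normed
          (φ k).hasCompactSupport_normed x) fun t => ?_
      rcases le_or_gt ‖t‖ 1 with ht | ht
      · have h3 := le_tangentEnvelope hV (x - t) (R := k) (y := 0) (by simp)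
        have h4 := (abs_le.1 ((V' 0).le_opNorm (x - t))).1
        have h5 : ‖V' 0‖ * ‖x - t‖ ≤ ‖V' 0‖ * (‖x‖ + 1) := by
          gcongr
          exact (norm_sub_le _ _).trans (by gcongr)
        rw [sub_zero] at h3
        simp only [smul_eq_mul]
        rw [mul_comm]
        refine mul_le_mul_of_nonneg_right ?_ ((φ k).nonneg_normed t)
        change _ ≤ tangentEnvelope V V' k (x - t)
        linarith
      · simp [hsupp k t ht]
    have h6 : ‖V' 0‖ * ‖x‖ ≤ ρ / 4 * ‖x‖ ^ 2 + ‖V' 0‖ ^ 2 / ρ := by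
      rw [← sub_nonneg]
      have : ρ / 4 * ‖x‖ ^ 2 + ‖V' 0‖ ^ 2 / ρ - ‖V' 0‖ * ‖x‖
          = (ρ * ‖x‖ / 2 - ‖V' 0‖) ^ 2 / ρ := by field_simp; ring
      rw [this]
      positivity
    linarith
  · refine Filter.Tendsto.const_add _ ?_
    refine (ContDiffBump.convolution_tendsto_right_of_continuous (μ := ν) hφ0 hVc x).congr' ?_
    obtain ⟨n, hn⟩ := exists_nat_ge (‖x‖ + 1)
    filter_upwards [Filter.eventually_ge_atTop n] with k hk
    refine integral_congr_ae (Filter.Eventually.of_forall fun t => ?_)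
    rcases le_or_gt ‖t‖ 1 with ht | ht
    · have h1 : f k (x - t) = V (x - t) := by
        refine tangentEnvelope_eq hV (Nat.cast_nonneg k) ?_
        have : (n : ℝ) ≤ k := by exact_mod_cast hk
        linarith [norm_sub_le x t]
      simp [h1, mul_comm]
    · simp [hsupp k t ht]

end Envelope

section GibbsEntropy

variable {ι : Type} {E : Type*} [Fintype ι] [NormedAddCommGroup E] [InnerProductSpace ℝ E]
  [FiniteDimensional ℝ E] [MeasurableSpace E] [BorelSpace E] {ν : Measure E}
  [ν.IsAddHaarMeasure] {α c ρ M A K K' L L' m₀ m₁ C : ℝ} {Φ Φ' Φ'' : ℝ → ℝ} {H : E → ℝ}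
  {b : E → E} {g : E → ℝ}

lemma isProbabilityMeasure_gibbs (hi : Integrable (fun x => Real.exp (-H x)) ν)
    (h1 : ∫ x, Real.exp (-H x) ∂ν = 1) :
    IsProbabilityMeasure (ν.withDensity fun x => ENNReal.ofReal (Real.exp (-H x))) := by
  constructor
  rw [withDensity_apply _ MeasurableSet.univ, Measure.restrict_univ,
    ← ofReal_integral_eq_lintegral_ofReal hi
      (Filter.Eventually.of_forall fun x => Real.exp_nonneg _), h1, ENNReal.ofReal_one]

/-- The entropy inequality for an unnormalized Gibbs density with regular potential. -/
lemma entropy_le_gibbs_of_isRegularDrift (N : IsotropicNoise ι E) (hα : 0 < α)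
    (hH : ∀ x, α * ‖x‖ ^ 2 - c ≤ H x) (hb : IsRegularDrift ρ M A b) (hM : 0 ≤ M) (hA : 0 ≤ A)
    (hρ : 0 < ρ) (hd : ∀ x, HasFDerivAt H (innerSL ℝ (b x)) x)
    (hΦ : IsEntropy m₀ m₁ C Φ Φ' Φ'') (hg : IsC11 K K' g) (hgm : ∀ x, g x ∈ Set.Icc m₀ m₁)
    (hΓ : IsC11 L L' (fun x => Φ'' (g x) * ‖fderiv ℝ g x‖ ^ 2)) :
    (∫ x, Φ (g x) * Real.exp (-H x) ∂ν) / (∫ x, Real.exp (-H x) ∂ν)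
      - Φ ((∫ x, g x * Real.exp (-H x) ∂ν) / ∫ x, Real.exp (-H x) ∂ν)
      ≤ (2 * ρ)⁻¹ * ((∫ x, Φ'' (g x) * ‖fderiv ℝ g x‖ ^ 2 * Real.exp (-H x) ∂ν)
        / ∫ x, Real.exp (-H x) ∂ν) := by
  have hHc : Continuous H := continuous_iff_continuousAt.2 fun x => (hd x).continuousAt
  set Z := ∫ x, Real.exp (-H x) ∂ν with hZ
  have hi : Integrable (fun x => Real.exp (-H x)) ν := by
    have := integrable_mul_exp_neg (ν := ν) (u := fun _ => 1) (C := 1) hα hHc hH continuous_const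
      fun x => by rw [abs_one]; nlinarith [norm_nonneg x]
    simpa using this
  have hZ0 : 0 < Z := integral_exp_pos hi
  have hexp : ∀ x, Real.exp (-(H x + Real.log Z)) = Real.exp (-H x) / Z := fun x => by
    rw [neg_add, Real.exp_add, Real.exp_neg (Real.log Z), Real.exp_log hZ0, div_eq_mul_inv]
  have hp : IsProbabilityMeasure
      (ν.withDensity fun x => ENNReal.ofReal (Real.exp (-(H x + Real.log Z)))) := by
    refine isProbabilityMeasure_gibbs (H := fun x => H x + Real.log Z) ?_ ?_
    · simp only [hexp]
      exact hi.div_const Z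
    · simp only [hexp, integral_div]
      exact div_self hZ0.ne'
  have hs := isLangevinStationary_gibbs (ν := ν) (H := fun x => H x + Real.log Z)
    (c := c - Real.log Z) hα (fun x => by linarith [hH x]) hb hM fun x => (hd x).add_const _
  have key := hs.entropy_le hb hρ hA N hΦ hg hgm hΓ
  have hI : ∀ u : E → ℝ, ∫ x, u x ∂(ν.withDensity fun x =>
      ENNReal.ofReal (Real.exp (-(H x + Real.log Z)))) = (∫ x, u x * Real.exp (-H x) ∂ν) / Z :=
    fun u => by
      rw [integral_gibbs (H := fun x => H x + Real.log Z) (hHc.add continuous_const)]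
      simp only [hexp, mul_div_assoc', integral_div]
  simpa only [hI] using key

/-- The entropy inequality for a Gibbs measure with strongly convex potential. -/
lemma entropy_le_gibbs (N : IsotropicNoise ι E) (hρ : 0 < ρ) {V : E → ℝ} {V' : E → E →L[ℝ] ℝ}
    (hV : ∀ x y, V y + V' y (x - y) ≤ V x) (hVc : Continuous V) (hV' : Continuous V')
    (hH : ∀ x, H x = ρ / 2 * ‖x‖ ^ 2 + V x) (h1 : ∫ x, Real.exp (-H x) ∂ν = 1)
    (hΦ : IsEntropy m₀ m₁ C Φ Φ' Φ'') (hg : IsC11 K K' g) (hgm : ∀ x, g x ∈ Set.Icc m₀ m₁)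
    (hΓ : IsC11 L L' (fun x => Φ'' (g x) * ‖fderiv ℝ g x‖ ^ 2)) :
    ∫ x, Φ (g x) * Real.exp (-H x) ∂ν - Φ (∫ x, g x * Real.exp (-H x) ∂ν)
      ≤ (2 * ρ)⁻¹ * ∫ x, Φ'' (g x) * ‖fderiv ℝ g x‖ ^ 2 * Real.exp (-H x) ∂ν := by
  obtain ⟨Hk, c, hreg, hlb, hlim⟩ := exists_regular_approx hρ hV hVc hV'
  have hHkc : ∀ k, Continuous (Hk k) := fun k => by
    obtain ⟨b, M, A, -, -, -, hd⟩ := hreg k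
    exact continuous_iff_continuousAt.2 fun x => (hd x).continuousAt
  have hα : 0 < ρ / 4 := by positivity
  have hT : ∀ (u : E → ℝ) (B : ℝ), Continuous u → (∀ x, |u x| ≤ B) →
      Filter.Tendsto (fun k => ∫ x, u x * Real.exp (-Hk k x) ∂ν) Filter.atTop
        (nhds (∫ x, u x * Real.exp (-H x) ∂ν)) := fun u B hu hB => by
    have hB0 : 0 ≤ B := (abs_nonneg _).trans (hB 0)
    refine tendsto_integral_of_dominated_convergence
      (fun x => B * Real.exp (-(ρ / 4 * ‖x‖ ^ 2 - c)))
      (fun k => (hu.mul (Real.continuous_exp.comp (hHkc k).neg)).aestronglyMeasurable)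
      (integrable_mul_exp_neg (u := fun _ => B) (C := B) hα (by fun_prop) (fun x => le_rfl)
        continuous_const fun x => ?_)
      (fun k => Filter.Eventually.of_forall fun x => ?_) (Filter.Eventually.of_forall fun x => ?_)
    · rw [abs_of_nonneg hB0]
      exact le_mul_of_one_le_right hB0 (by nlinarith [norm_nonneg x])
    · rw [norm_mul, Real.norm_eq_abs, Real.norm_of_nonneg (Real.exp_nonneg _)]
      gcongr
      · exact hB x
      · exact hlb k x
    · rw [hH x]
      exact ((Real.continuous_exp.tendsto _).comp (hlim x).neg).const_mul _
  have hZ : Filter.Tendsto (fun k => ∫ x, Real.exp (-Hk k x) ∂ν) Filter.atTop (nhds 1) := by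
    have := hT (fun _ => 1) 1 continuous_const (fun _ => by simp)
    simpa only [one_mul, h1] using this
  have hT' : ∀ (u : E → ℝ) (B : ℝ), Continuous u → (∀ x, |u x| ≤ B) →
      Filter.Tendsto (fun k => (∫ x, u x * Real.exp (-Hk k x) ∂ν) / ∫ x, Real.exp (-Hk k x) ∂ν)
        Filter.atTop (nhds (∫ x, u x * Real.exp (-H x) ∂ν)) := fun u B hu hB => by
    have := (hT u B hu hB).div hZ one_ne_zero
    rwa [div_one] at this
  have hgc : Continuous g := hg.differentiable.continuous
  have hΦg : Continuous fun x => Φ (g x) := continuous_iff_continuousAt.2 fun x =>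
    ContinuousAt.comp (hΦ.hasDerivAt _ (hgm x)).continuousAt hgc.continuousAt
  have hHc : Continuous H := by
    rw [funext hH]
    fun_prop
  have hi : Integrable (fun x => Real.exp (-H x)) ν := by
    by_contra h
    rw [integral_undef h] at h1
    exact zero_ne_one h1
  have hgB : ∀ x, |g x| ≤ max |m₀| |m₁| := fun x => abs_le_max_abs_abs (hgm x).1 (hgm x).2
  have hgi : Integrable (fun x => g x * Real.exp (-H x)) ν :=
    hi.bdd_mul hgc.aestronglyMeasurable (Filter.Eventually.of_forall hgB)
  have hmean : ∫ x, g x * Real.exp (-H x) ∂ν ∈ Set.Icc m₀ m₁ := by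
    constructor
    · rw [← mul_one m₀, ← h1, ← integral_const_mul]
      exact integral_mono (hi.const_mul _) hgi fun x =>
        mul_le_mul_of_nonneg_right (hgm x).1 (Real.exp_nonneg _)
    · rw [← mul_one m₁, ← h1, ← integral_const_mul]
      exact integral_mono hgi (hi.const_mul _) fun x =>
        mul_le_mul_of_nonneg_right (hgm x).2 (Real.exp_nonneg _)
  have hΓB : ∀ x, |Φ'' (g x) * ‖fderiv ℝ g x‖ ^ 2| ≤ C * K ^ 2 := fun x => by
    have h2 := hΦ.deriv2_mem _ (hgm x)
    rw [abs_of_nonneg (mul_nonneg h2.1 (sq_nonneg _))]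
    have h3 := h2.1.trans h2.2
    gcongr
    · exact h2.2
    · exact hg.norm_le x
  refine le_of_tendsto_of_tendsto' ((hT' _ C hΦg fun x => hΦ.abs_le _ (hgm x)).sub
    ((hΦ.hasDerivAt _ hmean).continuousAt.tendsto.comp (hT' _ _ hgc hgB)))
    ((hT' _ _ hΓ.differentiable.continuous hΓB).const_mul _) fun k => ?_
  obtain ⟨b, M, A, hb, hM, hA, hd⟩ := hreg k
  exact entropy_le_gibbs_of_isRegularDrift N hα (hlb k) hb hM hA hρ hd hΦ hg hgm hΓ

end GibbsEntropy

section Beckner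

variable {ι : Type} {E : Type*} [Fintype ι] [NormedAddCommGroup E] [InnerProductSpace ℝ E]
  [FiniteDimensional ℝ E] [MeasurableSpace E] [BorelSpace E] {ν : Measure E}
  [ν.IsAddHaarMeasure] {ρ : ℝ} {H : E → ℝ}

lemma exists_norm_sub_le_of_hasCompactSupport {F : Type*} [NormedAddCommGroup F]
    [NormedSpace ℝ F] {f : E → F} (hf : ContDiff ℝ 1 f)
    (hc : HasCompactSupport f) : ∃ L, ∀ x y, ‖f x - f y‖ ≤ L * ‖x - y‖ := by
  obtain ⟨L, hL⟩ := (hc.fderiv ℝ).exists_bound_of_continuous (hf.continuous_fderiv one_ne_zero)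
  refine ⟨L, fun x y => ?_⟩
  exact Convex.norm_image_sub_le_of_norm_fderiv_le (𝕜 := ℝ) (s := Set.univ)
    (fun z _ => hf.differentiable one_ne_zero z) (fun z _ => hL z) convex_univ (Set.mem_univ y)
    (Set.mem_univ x)

lemma exists_isC11_of_hasCompactSupport_fderiv {G : E → ℝ} (hG : ContDiff ℝ 2 G)
    (hc : HasCompactSupport (fderiv ℝ G)) : ∃ K L, IsC11 K L G := by
  have h1 : ContDiff ℝ 1 (fderiv ℝ G) := hG.fderiv_right (by norm_num)
  obtain ⟨K, hK⟩ := hc.exists_bound_of_continuous h1.continuous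
  obtain ⟨L, hL⟩ := exists_norm_sub_le_of_hasCompactSupport h1 hc
  exact ⟨K, L, hG.differentiable two_ne_zero, hK, hL⟩

/-- Beckner's inequality for positive functions which are constant outside a compact set. -/
lemma beckner_of_pos (N : IsotropicNoise ι E) (hρ : 0 < ρ) {V : E → ℝ} {V' : E → E →L[ℝ] ℝ}
    (hV : ∀ x y, V y + V' y (x - y) ≤ V x) (hVc : Continuous V) (hV' : Continuous V')
    (hH : ∀ x, H x = ρ / 2 * ‖x‖ ^ 2 + V x) (h1 : ∫ x, Real.exp (-H x) ∂ν = 1)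
    {q : ℝ} (hq : q ∈ Set.Ico (1 : ℝ) 2) {F : E → ℝ} {ε B : ℝ} (hε : 0 < ε)
    (hF : ContDiff ℝ 3 F) (hFm : ∀ x, F x ∈ Set.Icc ε B) (hFc : HasCompactSupport (fderiv ℝ F)) :
    ∫ x, F x ^ 2 * Real.exp (-H x) ∂ν - (∫ x, F x ^ q * Real.exp (-H x) ∂ν) ^ (2 / q)
      ≤ ((2 - q) / ρ) * ∫ x, ‖fderiv ℝ F x‖ ^ 2 * Real.exp (-H x) ∂ν := by
  obtain ⟨hq1, hq2⟩ := hq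
  have hq0 : 0 < q := by linarith
  have hFpos : ∀ x, 0 < F x := fun x => hε.trans_le (hFm x).1
  have hp1 : 1 ≤ 2 / q := by rw [le_div_iff₀ hq0]; linarith
  have hp2 : 2 / q ≤ 2 := by rw [div_le_iff₀ hq0]; linarith
  obtain ⟨C, hΦ⟩ := exists_isEntropy_rpow (Real.rpow_pos_of_pos hε q) (B ^ q) hp1 hp2
  have hgd : ∀ x, HasFDerivAt (fun x => F x ^ q) ((q * F x ^ (q - 1)) • fderiv ℝ F x) x := fun x =>
    (hF.differentiable (by norm_num) x).hasFDerivAt.rpow_const (Or.inl (hFpos x).ne')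
  have hgf : fderiv ℝ (fun x => F x ^ q) = fun x => (q * F x ^ (q - 1)) • fderiv ℝ F x :=
    funext fun x => (hgd x).fderiv
  have hgC : ContDiff ℝ 3 fun x => F x ^ q := hF.rpow_const_of_ne fun x => (hFpos x).ne'
  have hgc : HasCompactSupport (fderiv ℝ fun x => F x ^ q) := by
    rw [hgf]
    refine hFc.mono fun x hx => ?_
    rw [Function.mem_support] at hx ⊢
    exact fun h => hx (by rw [h, smul_zero])
  obtain ⟨K, K', hg⟩ := exists_isC11_of_hasCompactSupport_fderiv (hgC.of_le (by norm_num)) hgc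
  have hΓe : ∀ x, 2 / q * (2 / q - 1) * (F x ^ q) ^ (2 / q - 2) * ‖fderiv ℝ (fun x => F x ^ q) x‖ ^ 2
      = 2 * (2 - q) * ‖fderiv ℝ F x‖ ^ 2 := fun x => by
    have h2 : (F x ^ q) ^ (2 / q - 2) * (F x ^ (q - 1)) ^ 2 = 1 := by
      rw [← Real.rpow_mul (hFpos x).le, ← Real.rpow_natCast, ← Real.rpow_mul (hFpos x).le,
        ← Real.rpow_add (hFpos x)]
      have : q * (2 / q - 2) + (q - 1) * ((2 : ℕ) : ℝ) = 0 := by push_cast; field_simp; ring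
      rw [this, Real.rpow_zero]
    rw [hgf]
    simp only [norm_smul]
    rw [Real.norm_of_nonneg (mul_nonneg hq0.le (Real.rpow_nonneg (hFpos x).le _))]
    have h3 : 2 / q * (2 / q - 1) * q ^ 2 = 2 * (2 - q) := by field_simp
    linear_combination (2 / q * (2 / q - 1) * q ^ 2 * ‖fderiv ℝ F x‖ ^ 2) * h2
      + ‖fderiv ℝ F x‖ ^ 2 * h3
  have hΓC : ContDiff ℝ 2 fun x => 2 * (2 - q) * ‖fderiv ℝ F x‖ ^ 2 := by
    have h2 : ContDiff ℝ 2 fun x => (InnerProductSpace.toDual ℝ E).symm (fderiv ℝ F x) :=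
      (InnerProductSpace.toDual ℝ E).symm.contDiff.comp (hF.fderiv_right (by norm_num))
    have h3 := contDiff_const (c := 2 * (2 - q)).mul (h2.norm_sq ℝ)
    simpa only [LinearIsometryEquiv.norm_map] using h3
  have hΓc : HasCompactSupport fun x => 2 * (2 - q) * ‖fderiv ℝ F x‖ ^ 2 := by
    refine hFc.comp_left (g := fun φ => 2 * (2 - q) * ‖φ‖ ^ 2) ?_
    simp
  obtain ⟨L, L', hΓ⟩ := exists_isC11_of_hasCompactSupport_fderiv hΓC (hΓc.fderiv ℝ)
  have key := entropy_le_gibbs (ν := ν) N hρ hV hVc hV' hH h1 hΦ hg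
    (fun x => ⟨Real.rpow_le_rpow hε.le (hFm x).1 hq0.le,
      Real.rpow_le_rpow (hFpos x).le (hFm x).2 hq0.le⟩) (by simpa only [hΓe] using hΓ)
  simp only [hΓe] at key
  have h4 : ∀ x, (F x ^ q) ^ (2 / q) = F x ^ 2 := fun x => by
    rw [← Real.rpow_mul (hFpos x).le, mul_div_cancel₀ _ hq0.ne', Real.rpow_two]
  simp only [h4] at key
  refine key.trans (le_of_eq ?_)
  simp only [mul_assoc (2 * (2 - q)), integral_const_mul]
  field_simp

end Beckner

section BecknerGibbs

variable {E : Type*} [NormedAddCommGroup E] [InnerProductSpace ℝ E]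

lemma hasFDerivAt_sqrt_sq_add {h : E → ℝ} {ε : ℝ} (hε : 0 < ε) {x : E}
    (hh : DifferentiableAt ℝ h x) :
    HasFDerivAt (fun x => √(h x ^ 2 + ε ^ 2)) ((h x / √(h x ^ 2 + ε ^ 2)) • fderiv ℝ h x) x := by
  have h1 : HasFDerivAt (fun x => h x ^ 2 + ε ^ 2) ((2 * h x) • fderiv ℝ h x) x := by
    simpa using (hh.hasFDerivAt.pow 2).add_const (ε ^ 2)
  have h0 : h x ^ 2 + ε ^ 2 ≠ 0 := by positivity
  refine (h1.sqrt h0).congr_fderiv ?_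
  rw [smul_smul]
  congr 1
  field_simp

lemma norm_fderiv_sqrt_sq_add_le {h : E → ℝ} {ε : ℝ} (hε : 0 < ε) {x : E}
    (hh : DifferentiableAt ℝ h x) :
    ‖fderiv ℝ (fun x => √(h x ^ 2 + ε ^ 2)) x‖ ≤ ‖fderiv ℝ h x‖ := by
  rw [(hasFDerivAt_sqrt_sq_add hε hh).fderiv, norm_smul, norm_div,
    Real.norm_of_nonneg (Real.sqrt_nonneg _)]
  refine mul_le_of_le_one_left (norm_nonneg _) ?_
  have h0 : 0 < √(h x ^ 2 + ε ^ 2) := by positivity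
  rw [div_le_one h0]
  exact Real.abs_le_sqrt (by nlinarith)

variable [FiniteDimensional ℝ E]

/-- Smooth cut-offs, with explicit bounds on the gradient. -/
lemma exists_cutoff : ∃ (χ : ℕ → E → ℝ) (D : ℝ), (∀ n, ContDiff ℝ 3 (χ n)) ∧
    (∀ n, HasCompactSupport (χ n)) ∧ (∀ n x, χ n x ∈ Set.Icc (0 : ℝ) 1) ∧
    (∀ (n : ℕ) x, ‖x‖ ≤ n + 1 → χ n x = 1) ∧
    ∀ (n : ℕ) x, ‖fderiv ℝ (χ n) x‖ ≤ D / (n + 1) := by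
  let φ : ContDiffBump (0 : E) := ⟨1, 2, one_pos, one_lt_two⟩
  have hφ : ContDiff ℝ 3 φ := φ.contDiff
  have hφc : HasCompactSupport φ := φ.hasCompactSupport
  obtain ⟨D, hD⟩ := (hφc.fderiv ℝ).exists_bound_of_continuous
    (hφ.continuous_fderiv (by norm_num))
  have hn : ∀ n : ℕ, (0 : ℝ) < 1 / (n + 1) := fun n => by positivity
  refine ⟨fun n x => φ ((1 / (n + 1 : ℝ)) • x), D, fun n => hφ.comp (contDiff_const_smul _),
    fun n => hφc.comp_smul (hn n).ne', fun n x => ⟨φ.nonneg, φ.le_one⟩, fun n x hx => ?_,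
    fun n x => ?_⟩
  · refine φ.one_of_mem_closedBall ?_
    rw [mem_closedBall_zero_iff, norm_smul, Real.norm_of_nonneg (hn n).le]
    change _ ≤ (1 : ℝ)
    rw [one_div, inv_mul_le_iff₀ (by positivity), mul_one]
    exact hx
  · have h1 : HasFDerivAt (fun x : E => φ ((1 / (n + 1 : ℝ)) • x)) _ x :=
      (hφ.differentiable (by norm_num) _).hasFDerivAt.comp x
        ((hasFDerivAt_id x).const_smul (1 / (n + 1 : ℝ)))
    rw [h1.fderiv, ContinuousLinearMap.comp_smul, norm_smul, Real.norm_of_nonneg (hn n).le,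
      one_div, div_eq_inv_mul]
    gcongr
    exact hD _

variable {ι : Type} [Fintype ι] [MeasurableSpace E] [BorelSpace E] {ν : Measure E}
  [ν.IsAddHaarMeasure] {ρ : ℝ} {H : E → ℝ}

/-- Beckner's inequality for Gibbs measures with strongly convex potential. -/
lemma beckner_gibbs (N : IsotropicNoise ι E) (hρ : 0 < ρ) {V : E → ℝ} {V' : E → E →L[ℝ] ℝ}
    (hV : ∀ x y, V y + V' y (x - y) ≤ V x) (hVc : Continuous V) (hV' : Continuous V')
    (hH : ∀ x, H x = ρ / 2 * ‖x‖ ^ 2 + V x) (h1 : ∫ x, Real.exp (-H x) ∂ν = 1)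
    {q : ℝ} (hq : q ∈ Set.Ico (1 : ℝ) 2) {f : E → ℝ} {C C' : ℝ} (hf : ContDiff ℝ 3 f)
    (hC : ∀ x, |f x| ≤ C) (hC' : ∀ x, ‖fderiv ℝ f x‖ ≤ C') :
    ∫ x, f x ^ 2 * Real.exp (-H x) ∂ν - (∫ x, |f x| ^ q * Real.exp (-H x) ∂ν) ^ (2 / q)
      ≤ ((2 - q) / ρ) * ∫ x, ‖fderiv ℝ f x‖ ^ 2 * Real.exp (-H x) ∂ν := by
  have hq0 : 0 < q := by linarith [hq.1]
  have hC0 : 0 ≤ C := (abs_nonneg _).trans (hC 0)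
  have hC0' : 0 ≤ C' := (norm_nonneg _).trans (hC' 0)
  have hHc : Continuous H := by
    rw [funext hH]
    fun_prop
  have hi : Integrable (fun x => Real.exp (-H x)) ν := by
    by_contra h
    rw [integral_undef h] at h1
    exact zero_ne_one h1
  have hT : ∀ (u : ℕ → E → ℝ) (v : E → ℝ) (B : ℝ), (∀ n, Continuous (u n)) →
      (∀ n x, |u n x| ≤ B) →
      (∀ x, Filter.Tendsto (fun n => u n x) Filter.atTop (nhds (v x))) →
      Filter.Tendsto (fun n => ∫ x, u n x * Real.exp (-H x) ∂ν) Filter.atTop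
        (nhds (∫ x, v x * Real.exp (-H x) ∂ν)) := fun u v B hu hB hlim => by
    refine tendsto_integral_of_dominated_convergence (fun x => B * Real.exp (-H x))
      (fun n => ((hu n).mul (by fun_prop)).aestronglyMeasurable) (hi.const_mul B)
      (fun n => Filter.Eventually.of_forall fun x => ?_)
      (Filter.Eventually.of_forall fun x => (hlim x).mul_const _)
    rw [norm_mul, Real.norm_eq_abs, Real.norm_of_nonneg (Real.exp_nonneg _)]
    gcongr
    exact hB n x
  obtain ⟨χ, D, hχ, hχc, hχm, hχ1, hχD⟩ := exists_cutoff (E := E)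
  have hD0 : 0 ≤ D := by simpa using (norm_nonneg _).trans (hχD 0 0)
  let ε : ℕ → ℝ := fun n => 1 / (n + 1)
  have hε : ∀ n, 0 < ε n := fun n => by positivity
  have hε1 : ∀ n, ε n ≤ 1 := fun n => by
    change 1 / (n + 1 : ℝ) ≤ 1
    rw [div_le_one (by positivity)]
    linarith [(Nat.cast_nonneg n : (0 : ℝ) ≤ n)]
  have hε0 : Filter.Tendsto ε Filter.atTop (nhds 0) := tendsto_one_div_add_atTop_nhds_zero_nat
  let h : ℕ → E → ℝ := fun n x => χ n x * f x
  have hh : ∀ n, ContDiff ℝ 3 (h n) := fun n => (hχ n).mul hf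
  have hhd : ∀ n x, DifferentiableAt ℝ (h n) x := fun n x => (hh n).differentiable (by norm_num) x
  have hhc : ∀ n, HasCompactSupport (h n) := fun n => (hχc n).mul_right
  have hhC : ∀ n x, |h n x| ≤ C := fun n x => by
    rw [abs_mul, abs_of_nonneg (hχm n x).1]
    exact (mul_le_of_le_one_left (abs_nonneg _) (hχm n x).2).trans (hC x)
  let F : ℕ → E → ℝ := fun n x => √(h n x ^ 2 + ε n ^ 2)
  have hpos : ∀ n x, 0 < h n x ^ 2 + ε n ^ 2 := fun n x => by have := hε n; positivity
  have hF : ∀ n, ContDiff ℝ 3 (F n) := fun n =>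
    (((hh n).pow 2).add contDiff_const).sqrt fun x => (hpos n x).ne'
  have hFm : ∀ n x, F n x ∈ Set.Icc (ε n) (C + 1) := fun n x => by
    constructor
    · exact Real.le_sqrt_of_sq_le (by nlinarith [sq_nonneg (h n x)])
    · refine Real.sqrt_le_iff.2 ⟨by positivity, ?_⟩
      have h2 : h n x ^ 2 ≤ C ^ 2 := sq_le_sq.2 (by rw [abs_of_nonneg hC0]; exact hhC n x)
      nlinarith [hε n, hε1 n]
  have hFc : ∀ n, HasCompactSupport (fderiv ℝ (F n)) := fun n => by
    refine ((hhc n).fderiv ℝ).mono fun x hx => ?_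
    rw [Function.mem_support] at hx ⊢
    exact fun h0 => hx (by rw [(hasFDerivAt_sqrt_sq_add (hε n) (hhd n x)).fderiv, h0, smul_zero])
  have hDF : ∀ n x, ‖fderiv ℝ (F n) x‖ ≤ ‖fderiv ℝ f x‖ + C * D * ε n := fun n x => by
    refine (norm_fderiv_sqrt_sq_add_le (hε n) (hhd n x)).trans ?_
    have h2 := ((hχ n).differentiable (by norm_num) x).hasFDerivAt.mul
      (hf.differentiable (by norm_num) x).hasFDerivAt
    rw [show h n = χ n * f from rfl, h2.fderiv]
    refine (norm_add_le _ _).trans (add_le_add ?_ ?_)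
    · rw [norm_smul, Real.norm_of_nonneg (hχm n x).1]
      exact mul_le_of_le_one_left (norm_nonneg _) (hχm n x).2
    · rw [norm_smul, mul_assoc]
      have h3 := hχD n x
      rw [div_eq_mul_one_div] at h3
      gcongr
      exact hC x
  have hFl : ∀ x, Filter.Tendsto (fun n => F n x) Filter.atTop (nhds |f x|) := fun x => by
    have h2 : Filter.Tendsto (fun n => √(f x ^ 2 + ε n ^ 2)) Filter.atTop (nhds |f x|) := by
      rw [← Real.sqrt_sq_eq_abs]
      refine (Real.continuous_sqrt.tendsto _).comp ?_
      simpa using (hε0.pow 2).const_add (f x ^ 2)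
    refine h2.congr' ?_
    obtain ⟨m, hm⟩ := exists_nat_ge ‖x‖
    filter_upwards [Filter.eventually_ge_atTop m] with n hn
    have h3 : (m : ℝ) ≤ n := by exact_mod_cast hn
    have h4 : χ n x = 1 := hχ1 n x (by linarith)
    simp only [F, h, h4, one_mul]
  have hFpos : ∀ n x, 0 < F n x := fun n x => (hε n).trans_le (hFm n x).1
  have l1 := hT (fun n x => F n x ^ 2) (fun x => f x ^ 2) ((C + 1) ^ 2)
    (fun n => (hF n).continuous.pow 2)
    (fun n x => by
      rw [abs_of_nonneg (sq_nonneg _)]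
      exact pow_le_pow_left₀ (hFpos n x).le (hFm n x).2 2)
    (fun x => by simpa using (hFl x).pow 2)
  have l2 := hT (fun n x => F n x ^ q) (fun x => |f x| ^ q) ((C + 1) ^ q)
    (fun n => (hF n).continuous.rpow_const fun x => Or.inr hq0.le)
    (fun n x => by
      rw [abs_of_nonneg (Real.rpow_nonneg (hFpos n x).le _)]
      exact Real.rpow_le_rpow (hFpos n x).le (hFm n x).2 hq0.le)
    (fun x => (hFl x).rpow_const (Or.inr hq0.le))
  have hfc : Continuous fun x => ‖fderiv ℝ f x‖ := (hf.continuous_fderiv (by norm_num)).norm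
  have hCD : ∀ n, C * D * ε n ≤ C * D := fun n =>
    mul_le_of_le_one_right (mul_nonneg hC0 hD0) (hε1 n)
  have hCD0 : ∀ n, 0 ≤ C * D * ε n := fun n => mul_nonneg (mul_nonneg hC0 hD0) (hε n).le
  have hb : ∀ n x, |(‖fderiv ℝ f x‖ + C * D * ε n) ^ 2| ≤ (C' + C * D) ^ 2 := fun n x => by
    rw [abs_of_nonneg (sq_nonneg _)]
    exact pow_le_pow_left₀ (add_nonneg (norm_nonneg _) (hCD0 n)) (add_le_add (hC' x) (hCD n)) 2
  have l3 := hT (fun n x => (‖fderiv ℝ f x‖ + C * D * ε n) ^ 2) (fun x => ‖fderiv ℝ f x‖ ^ 2)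
    ((C' + C * D) ^ 2) (fun n => (hfc.add continuous_const).pow 2) hb
    (fun x => by
      have := ((hε0.const_mul (C * D)).const_add ‖fderiv ℝ f x‖).pow 2
      simpa using this)
  refine le_of_tendsto_of_tendsto' (l1.sub (l2.rpow_const (Or.inr (by positivity))))
    (l3.const_mul _) fun n => ?_
  refine (beckner_of_pos N hρ hV hVc hV' hH h1 hq (hε n) (hF n) (hFm n) (hFc n)).trans ?_
  refine mul_le_mul_of_nonneg_left ?_ (div_nonneg (by linarith [hq.2]) hρ.le)
  refine integral_mono_of_nonneg (Filter.Eventually.of_forall fun x => by positivity)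
    (hi.bdd_mul ((hfc.add continuous_const).pow 2).aestronglyMeasurable
      (Filter.Eventually.of_forall (hb n))) (Filter.Eventually.of_forall fun x => ?_)
  exact mul_le_mul_of_nonneg_right (pow_le_pow_left₀ (norm_nonneg _) (hDF n x) 2)
    (Real.exp_nonneg _)

end BecknerGibbs

/-- The tangent inequality for a function whose Hessian is bounded below. -/
lemma tangent_le_of_le_hessian {E : Type*} [NormedAddCommGroup E] [InnerProductSpace ℝ E]
    {ρ : ℝ} {H : E → ℝ} (hH : ContDiff ℝ 2 H)
    (hHess : ∀ x y : E, ρ * ‖y‖ ^ 2 ≤ iteratedFDeriv ℝ 2 H x ![y, y]) (x y : E) :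
    H y + fderiv ℝ H y (x - y) + ρ / 2 * ‖x - y‖ ^ 2 ≤ H x := by
  set v := x - y with hv
  have hl : ∀ t : ℝ, HasDerivAt (fun t : ℝ => y + t • v) v t := fun t => by
    simpa using ((hasDerivAt_id t).smul_const v).const_add y
  have hd : ContDiff ℝ 1 (fderiv ℝ H) := hH.fderiv_right (by norm_num)
  have h1 : ∀ t : ℝ, HasDerivAt (fun t : ℝ => H (y + t • v)) (fderiv ℝ H (y + t • v) v) t :=
    fun t => (hH.differentiable two_ne_zero _).hasFDerivAt.comp_hasDerivAt t (hl t)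
  have h2 : ∀ t : ℝ, HasDerivAt (fun t : ℝ => fderiv ℝ H (y + t • v) v)
      (fderiv ℝ (fderiv ℝ H) (y + t • v) v v) t := fun t => by
    have := ((hd.differentiable one_ne_zero _).hasFDerivAt.comp_hasDerivAt t (hl t))
    simpa using this.clm_apply (hasDerivAt_const t v)
  have h3 : ∀ t : ℝ, HasDerivAt (fun t : ℝ => fderiv ℝ H (y + t • v) v - ρ * ‖v‖ ^ 2 * t)
      (fderiv ℝ (fderiv ℝ H) (y + t • v) v v - ρ * ‖v‖ ^ 2) t := fun t => by
    exact ((h2 t).sub ((hasDerivAt_id t).const_mul (ρ * ‖v‖ ^ 2))).congr_deriv (by rw [mul_one])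
  have h4 : Monotone fun t : ℝ => fderiv ℝ H (y + t • v) v - ρ * ‖v‖ ^ 2 * t := by
    refine monotone_of_deriv_nonneg (fun t => (h3 t).differentiableAt) fun t => ?_
    rw [(h3 t).deriv, sub_nonneg]
    simpa [iteratedFDeriv_two_apply] using hHess (y + t • v) v
  have h5 : ∀ t : ℝ, HasDerivAt
      (fun t : ℝ => H (y + t • v) - ρ / 2 * ‖v‖ ^ 2 * t ^ 2 - fderiv ℝ H y v * t)
      (fderiv ℝ H (y + t • v) v - ρ * ‖v‖ ^ 2 * t - fderiv ℝ H y v) t := fun t => by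
    refine (((h1 t).sub ((hasDerivAt_pow 2 t).const_mul (ρ / 2 * ‖v‖ ^ 2))).sub
      ((hasDerivAt_id t).const_mul (fderiv ℝ H y v))).congr_deriv ?_
    push_cast
    ring
  have h6 := monotoneOn_of_deriv_nonneg (convex_Icc (0 : ℝ) 1)
    (fun t _ => (h5 t).continuousAt.continuousWithinAt)
    (fun t _ => (h5 t).differentiableAt.differentiableWithinAt) (fun t ht => by
      rw [interior_Icc] at ht
      rw [(h5 t).deriv, sub_nonneg]
      simpa using h4 ht.1.le) (Set.left_mem_Icc.2 zero_le_one) (Set.right_mem_Icc.2 zero_le_one)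
    zero_le_one
  have h7 : y + v = x := by rw [hv]; abel
  simp only [zero_smul, add_zero, one_smul, h7] at h6
  linarith

/-- **Beckner-type inequalities for uniformly strictly log-concave measures.** If
`dμ = exp(−H) dx` on `ℝ^d` with `Hess H ≥ ρ > 0`, then for every `q ∈ [1,2)` and smooth
bounded `f` with bounded gradient,
`∫ f² dμ − (∫ |f|^q dμ)^{2/q} ≤ ((2−q)/ρ) ∫ ‖∇f‖² dμ`. -/
theorem beckner_logConcave
    {d : ℕ} (ρ : ℝ) (hρ : 0 < ρ)
    (H : EuclideanSpace ℝ (Fin d) → ℝ) (hH : ContDiff ℝ (⊤ : ℕ∞) H)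
    (hHess : ∀ x y : EuclideanSpace ℝ (Fin d),
      ρ * ‖y‖ ^ 2 ≤ iteratedFDeriv ℝ 2 H x ![y, y])
    (μ : Measure (EuclideanSpace ℝ (Fin d))) [IsProbabilityMeasure μ]
    (hμ : μ = volume.withDensity fun x => ENNReal.ofReal (Real.exp (-H x))) :
    ∀ q : ℝ, q ∈ Set.Ico (1 : ℝ) 2 →
    ∀ f : EuclideanSpace ℝ (Fin d) → ℝ, ContDiff ℝ (⊤ : ℕ∞) f →
      (∃ C : ℝ, ∀ x, |f x| ≤ C) → (∃ C : ℝ, ∀ x, ‖gradient f x‖ ≤ C) →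
      (∫ x, f x ^ 2 ∂μ) - (∫ x, |f x| ^ q ∂μ) ^ (2 / q)
        ≤ ((2 - q) / ρ) * ∫ x, ‖gradient f x‖ ^ 2 ∂μ := by
  rintro q hq f hf ⟨C, hC⟩ ⟨C', hC'⟩
  obtain ⟨ι, _, ⟨N⟩⟩ := exists_isotropicNoise d
  have hgrad : ∀ x, ‖gradient f x‖ = ‖fderiv ℝ f x‖ := fun x =>
    (InnerProductSpace.toDual ℝ _).symm.norm_map _
  have hHc : Continuous H := hH.continuous
  have h1 : ∫ x, Real.exp (-H x) = 1 := by
    have := integral_gibbs (ν := volume) hHc fun _ => 1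
    rw [← hμ] at this
    simpa using this.symm
  have h2 : ContDiff ℝ 2 H := contDiff_infty.1 hH 2
  have h3 : ∀ x : EuclideanSpace ℝ (Fin d), HasFDerivAt (fun x => ‖x‖ ^ 2)
      (2 • innerSL ℝ x) x := fun x => (hasStrictFDerivAt_norm_sq x).hasFDerivAt
  have key := beckner_gibbs (ν := volume) (H := H) N hρ (V := fun x => H x - ρ / 2 * ‖x‖ ^ 2)
    (V' := fun x => fderiv ℝ H x - ρ • innerSL ℝ x) (fun x y => ?_) (by fun_prop) ?_
    (fun x => by ring) h1 hq (contDiff_infty.1 hf 3) hC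
    (fun x => by rw [← hgrad]; exact hC' x)
  · simp only [hμ, integral_gibbs hHc, hgrad]
    exact key
  · have h4 := tangent_le_of_le_hessian h2 hHess x y
    have h5 : ‖x‖ ^ 2 = ‖y‖ ^ 2 + 2 * inner ℝ y (x - y) + ‖x - y‖ ^ 2 := by
      rw [← norm_add_sq_real, add_sub_cancel]
    simp only [sub_apply, smul_apply, innerSL_apply_apply,
      smul_eq_mul]
    rw [h5]
    linarith
  · exact (h2.continuous_fderiv two_ne_zero).sub ((innerSL ℝ).continuous.const_smul ρ)
end

section
/- Let λ > 0 and let P_λ be the Poisson probability measure on ℕ with mean λ, i.e. P_λ({n}) = e^{−λ} λ^n / n!. Let I ⊆ ℝ be a closed interval and Φ : I → ℝ a C² convex function satisfying (H2). Then for every bounded function f : ℕ → I, Ent_{P_λ}^Φ(f) ≤ λ · ∫ Ψ(f(n), f(n+1) − f(n)) dP_λ(n). -/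
open MeasureTheory ProbabilityTheory

open Filter Topology

/-- The Markov operator on functions `ℕ → ℝ` of a random walk that jumps one step to the right with
probability `p` and stays in place with probability `1 - p`. -/
noncomputable def bernoulliStep (p : ℝ) : Module.End ℝ (ℕ → ℝ) :=
  p • LinearMap.funLeft ℝ ℝ Nat.succ + (1 - p) • 1

theorem bernoulliStep_apply (p : ℝ) (h : ℕ → ℝ) (n : ℕ) :
    bernoulliStep p h n = (1 - p) * h n + p * h (n + 1) := by
  simp [bernoulliStep, LinearMap.funLeft_apply, add_comm]

theorem funLeft_succ_pow_apply (k : ℕ) (h : ℕ → ℝ) (n : ℕ) :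
    (LinearMap.funLeft ℝ ℝ Nat.succ ^ k) h n = h (n + k) := by
  induction k generalizing h with
  | zero => simp
  | succ k ih => rw [pow_succ, Module.End.mul_apply, ih, LinearMap.funLeft_apply]; rfl

/-- Iterating the Bernoulli step gives averages against the binomial distribution. -/
theorem bernoulliStep_pow_apply_zero (p : ℝ) (m : ℕ) (h : ℕ → ℝ) :
    (bernoulliStep p ^ m) h 0 =
      ∑ k ∈ Finset.range (m + 1), m.choose k * p ^ k * (1 - p) ^ (m - k) * h k := by
  have hc : Commute (p • LinearMap.funLeft ℝ ℝ Nat.succ)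
      ((1 - p) • (1 : Module.End ℝ (ℕ → ℝ))) :=
    (Commute.one_right _).smul_right _
  rw [bernoulliStep, hc.add_pow, LinearMap.sum_apply, Finset.sum_apply]
  refine Finset.sum_congr rfl fun k _ => ?_
  rw [smul_pow, smul_pow, one_pow, smul_mul_smul_comm, mul_one, ← nsmul_eq_mul',
    LinearMap.smul_apply, LinearMap.smul_apply, Pi.smul_apply, Pi.smul_apply,
    funLeft_succ_pow_apply]
  simp [mul_assoc]

theorem bernoulliStep_mono {p : ℝ} (hp0 : 0 ≤ p) (hp1 : p ≤ 1) :
    Monotone (bernoulliStep p) := by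
  intro g h hgh n
  rw [bernoulliStep_apply, bernoulliStep_apply]
  have := sub_nonneg.2 hp1
  gcongr
  · exact hgh n
  · exact hgh (n + 1)

theorem bernoulliStep_pow_mono {p : ℝ} (hp0 : 0 ≤ p) (hp1 : p ≤ 1) (m : ℕ) :
    Monotone (bernoulliStep p ^ m : Module.End ℝ (ℕ → ℝ)) := by
  rw [Module.End.coe_pow]
  exact (bernoulliStep_mono hp0 hp1).iterate m

theorem Convex.bernoulliStep_mem {I : Set ℝ} (hI : Convex ℝ I) {p : ℝ} (hp0 : 0 ≤ p)
    (hp1 : p ≤ 1) {f : ℕ → ℝ} (hf : ∀ n, f n ∈ I) (n : ℕ) : bernoulliStep p f n ∈ I := by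
  rw [bernoulliStep_apply]
  exact hI (hf n) (hf (n + 1)) (sub_nonneg.2 hp1) hp0 (by ring)

theorem Convex.bernoulliStep_pow_mem {I : Set ℝ} (hI : Convex ℝ I) {p : ℝ} (hp0 : 0 ≤ p)
    (hp1 : p ≤ 1) (m : ℕ) {f : ℕ → ℝ} (hf : ∀ n, f n ∈ I) (n : ℕ) :
    (bernoulliStep p ^ m) f n ∈ I := by
  induction m generalizing f with
  | zero => simpa using hf n
  | succ m ih =>
    rw [pow_succ, Module.End.mul_apply]
    exact ih (hI.bernoulliStep_mem hp0 hp1 hf)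

/-- **Φ-Sobolev inequality for the binomial distribution**, where `g` is a selection of
subgradients of `Φ` whose Bregman divergence is jointly convex. -/
theorem bernoulliStep_entropy_le {I : Set ℝ} (hI : Convex ℝ I) {Φ g : ℝ → ℝ}
    (hnonneg : ∀ u ∈ I, ∀ w ∈ I, 0 ≤ Φ w - Φ u - g u * (w - u))
    (hconv : ConvexOn ℝ (I ×ˢ I) fun q : ℝ × ℝ => Φ q.2 - Φ q.1 - g q.1 * (q.2 - q.1))
    {p : ℝ} (hp0 : 0 ≤ p) (hp1 : p ≤ 1) (m : ℕ) {f : ℕ → ℝ} (hf : ∀ n, f n ∈ I) (n : ℕ) :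
    (bernoulliStep p ^ (m + 1)) (fun k => Φ (f k)) n - Φ ((bernoulliStep p ^ (m + 1)) f n) ≤
      (m + 1) * p * (bernoulliStep p ^ m)
        (fun k => Φ (f (k + 1)) - Φ (f k) - g (f k) * (f (k + 1) - f k)) n := by
  have one_step : ∀ {f : ℕ → ℝ}, (∀ n, f n ∈ I) → ∀ n,
      bernoulliStep p (fun k => Φ (f k)) n - Φ (bernoulliStep p f n) ≤
        p * (Φ (f (n + 1)) - Φ (f n) - g (f n) * (f (n + 1) - f n)) := by
    intro f hf n
    have := hnonneg _ (hf n) _ (hI.bernoulliStep_mem hp0 hp1 hf n)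
    simp only [bernoulliStep_apply] at this ⊢
    linarith
  induction m generalizing f with
  | zero => simpa using one_step hf n
  | succ m ih =>
    have hBf := hI.bernoulliStep_mem hp0 hp1 hf
    have h_rec := ih hBf
    have h_step := bernoulliStep_pow_mono hp0 hp1 (m + 1)
      (show bernoulliStep p (fun k => Φ (f k)) ≤ (fun k => Φ (bernoulliStep p f k)) +
        p • (fun k => Φ (f (k + 1)) - Φ (f k) - g (f k) * (f (k + 1) - f k)) from fun k => by
          have := one_step hf k
          simp only [Pi.add_apply, Pi.smul_apply, smul_eq_mul]
          linarith) n
    have h_jensen := bernoulliStep_pow_mono hp0 hp1 m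
      (show (fun k => Φ (bernoulliStep p f (k + 1)) - Φ (bernoulliStep p f k) -
          g (bernoulliStep p f k) * (bernoulliStep p f (k + 1) - bernoulliStep p f k)) ≤
        bernoulliStep p (fun k => Φ (f (k + 1)) - Φ (f k) - g (f k) * (f (k + 1) - f k))
        from fun k => by
          have := hconv.2 (Set.mk_mem_prod (hf k) (hf (k + 1)))
            (Set.mk_mem_prod (hf (k + 1)) (hf (k + 1 + 1))) (sub_nonneg.2 hp1) hp0 (by ring)
          simpa [bernoulliStep_apply] using this) n
    rw [map_add, map_smul] at h_step
    simp only [Pi.add_apply, Pi.smul_apply, smul_eq_mul] at h_step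
    have h_mul := mul_le_mul_of_nonneg_left h_jensen (show 0 ≤ (m + 1) * p by positivity)
    simp only [← Module.End.mul_apply, ← pow_succ] at h_rec h_step h_mul
    push_cast
    linarith

/-- Binomial averages of a bounded function converge to its Poisson average. -/
theorem tendsto_bernoulliStep_pow_poissonMeasure {lam : NNReal} {p : ℕ → ℝ}
    (hp0 : ∀ᶠ m in atTop, 0 ≤ p m) (hp1 : ∀ᶠ m in atTop, p m ≤ 1)
    (hp : Tendsto (fun m : ℕ => m * p m) atTop (𝓝 lam))
    {h : ℕ → ℝ} {C : ℝ} (hC : ∀ n, |h n| ≤ C) :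
    Tendsto (fun m => (bernoulliStep (p m) ^ m) h 0) atTop
      (𝓝 (∫ n, h n ∂(poissonMeasure lam))) := by
  have hsum : ∀ m, (bernoulliStep (p m) ^ m) h 0 =
      ∑' k, m.choose k * p m ^ k * (1 - p m) ^ (m - k) * h k := by
    intro m
    rw [bernoulliStep_pow_apply_zero, tsum_eq_sum]
    intro k hk
    rw [Nat.choose_eq_zero_of_lt (by simpa using hk)]
    simp
  simp only [hsum, integral_poissonMeasure, smul_eq_mul]
  have hlt : ∀ᶠ m : ℕ in atTop, m * p m < lam + 1 := hp.eventually_lt_const (by simp)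
  refine tendsto_tsum_of_dominated_convergence
    (bound := fun k => ((lam : ℝ) + 1) ^ k / k.factorial * C)
    ((Real.summable_pow_div_factorial _).mul_right C)
    (fun k => (tendsto_choose_mul_pow_of_tendsto_mul_atTop k hp).mul_const _) ?_
  filter_upwards [hp0, hp1, hlt] with m h0 h1 h2 k
  have h3 : 0 ≤ 1 - p m := sub_nonneg.2 h1
  rw [norm_mul, Real.norm_eq_abs, Real.norm_eq_abs, abs_of_nonneg (by positivity)]
  refine mul_le_mul ?_ (hC k) (abs_nonneg _) (by positivity)
  calc (m.choose k : ℝ) * p m ^ k * (1 - p m) ^ (m - k)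
      ≤ m.choose k * p m ^ k * 1 := by
        gcongr
        exact pow_le_one₀ h3 (by linarith)
    _ ≤ (m : ℝ) ^ k / k.factorial * p m ^ k * 1 := by
        gcongr
        exact Nat.choose_le_pow_div k m
    _ = (m * p m) ^ k / k.factorial := by rw [mul_pow]; ring
    _ ≤ _ := by gcongr

/-- A function which is convex on a square is bounded above on it. -/
theorem ConvexOn.exists_forall_le_of_mem_Icc {I : Set ℝ} {F : ℝ × ℝ → ℝ}
    (hF : ConvexOn ℝ (I ×ˢ I) F) {a b : ℝ} (ha : a ∈ I) (hb : b ∈ I) :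
    ∃ C, ∀ u ∈ Set.Icc a b, ∀ w ∈ Set.Icc a b, F (u, w) ≤ C := by
  refine ⟨max (max (F (a, a)) (F (b, a))) (max (F (a, b)) (F (b, b))), fun u hu w hw => ?_⟩
  have hab : a ≤ b := hu.1.trans hu.2
  rw [← segment_eq_Icc hab] at hu hw
  have hI : Convex ℝ I := by
    have := hF.1.linear_image (LinearMap.fst ℝ ℝ ℝ)
    rwa [LinearMap.coe_fst, Set.fst_image_prod _ ⟨a, ha⟩] at this
  have hu' : u ∈ I := hI.segment_subset ha hb hu
  have horiz : ∀ c ∈ I, F (u, c) ≤ max (F (a, c)) (F (b, c)) := fun c hc =>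
    hF.le_on_segment ⟨ha, hc⟩ ⟨hb, hc⟩ (by
      rw [← Prod.image_mk_segment_left]
      exact ⟨u, hu, rfl⟩)
  have vert : F (u, w) ≤ max (F (u, a)) (F (u, b)) :=
    hF.le_on_segment ⟨hu', ha⟩ ⟨hu', hb⟩ (by
      rw [← Prod.image_mk_segment_right]
      exact ⟨w, hw, rfl⟩)
  exact vert.trans (max_le_max (horiz a ha) (horiz b hb))

/-- **Φ-Sobolev inequality for the simple Poisson measure.** Under hypothesis `(H2)` (the
function `Ψ(u,v) = Φ(u+v) − Φ(u) − Φ'(u)v` is nonnegative and convex on `I⁽²⁾`), the Poisson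
measure `P_λ` of mean `λ > 0` on `ℕ` satisfies, for every bounded `f : ℕ → I`,
`Ent_{P_λ}^Φ(f) ≤ λ ∫ Ψ(f(n), f(n+1) − f(n)) dP_λ(n)`. -/
theorem phiSobolev_poisson
    (lam : NNReal) (hlam : 0 < lam)
    (I : Set ℝ) (hI : Convex ℝ I) (hIc : IsClosed I)
    (Φ : ℝ → ℝ) (hΦ : ContDiffOn ℝ 2 Φ I) (hΦconv : ConvexOn ℝ I Φ)
    (hH2nonneg : ∀ u v : ℝ, u ∈ I → u + v ∈ I →
      0 ≤ Φ (u + v) - Φ u - deriv Φ u * v)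
    (hH2conv : ConvexOn ℝ {p : ℝ × ℝ | p.1 ∈ I ∧ p.1 + p.2 ∈ I}
      (fun p : ℝ × ℝ => Φ (p.1 + p.2) - Φ p.1 - deriv Φ p.1 * p.2))
    (f : ℕ → ℝ) (hfI : ∀ n, f n ∈ I) (hfbdd : ∃ C : ℝ, ∀ n, |f n| ≤ C) :
    (∫ n, Φ (f n) ∂(poissonMeasure lam)) - Φ (∫ n, f n ∂(poissonMeasure lam))
      ≤ (lam : ℝ) * ∫ n,
          (Φ (f n + (f (n + 1) - f n)) - Φ (f n) - deriv Φ (f n) * (f (n + 1) - f n))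
            ∂(poissonMeasure lam) := by
  simp only [add_sub_cancel]
  have hnonneg : ∀ u ∈ I, ∀ w ∈ I, 0 ≤ Φ w - Φ u - deriv Φ u * (w - u) := fun u hu w hw => by
    simpa using hH2nonneg u (w - u) hu (by simpa using hw)
  have hconv : ConvexOn ℝ (I ×ˢ I)
      fun q : ℝ × ℝ => Φ q.2 - Φ q.1 - deriv Φ q.1 * (q.2 - q.1) := by
    have := hH2conv.comp_linearMap
      ((LinearMap.fst ℝ ℝ ℝ).prod (LinearMap.snd ℝ ℝ ℝ - LinearMap.fst ℝ ℝ ℝ))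
    have hset : I ×ˢ I = ((LinearMap.fst ℝ ℝ ℝ).prod (LinearMap.snd ℝ ℝ ℝ - LinearMap.fst ℝ ℝ ℝ)) ⁻¹'
        {p : ℝ × ℝ | p.1 ∈ I ∧ p.1 + p.2 ∈ I} := by
      ext q
      simp
    rw [hset]
    refine this.congr fun q _ => ?_
    simp
  obtain ⟨C, hC⟩ := hfbdd
  have hK : IsCompact (I ∩ Set.Icc (-C) C) := isCompact_Icc.inter_left hIc
  have hfK : ∀ n, f n ∈ I ∩ Set.Icc (-C) C := fun n => ⟨hfI n, abs_le.1 (hC n)⟩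
  obtain ⟨a, ha⟩ := hK.exists_isLeast ⟨f 0, hfK 0⟩
  obtain ⟨b, hb⟩ := hK.exists_isGreatest ⟨f 0, hfK 0⟩
  have hfab : ∀ n, f n ∈ Set.Icc a b := fun n => ⟨ha.2 (hfK n), hb.2 (hfK n)⟩
  obtain ⟨A, hA⟩ := hK.exists_bound_of_continuousOn (hΦ.continuousOn.mono Set.inter_subset_left)
  obtain ⟨B, hB⟩ := hconv.exists_forall_le_of_mem_Icc ha.1.1 hb.1.1
  set S : ℕ → ℝ := fun n => Φ (f (n + 1)) - Φ (f n) - deriv Φ (f n) * (f (n + 1) - f n)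
  have hSB : ∀ n, |S n| ≤ B := fun n => by
    rw [abs_of_nonneg (hnonneg _ (hfI n) _ (hfI (n + 1)))]
    exact hB _ (hfab n) _ (hfab (n + 1))
  have hlim0 : Tendsto (fun m : ℕ => (lam : ℝ) / (m + 1)) atTop (𝓝 0) :=
    (tendsto_const_div_atTop_nhds_zero_nat (lam : ℝ)).comp (tendsto_add_atTop_nat 1)
      |>.congr fun m => by simp
  have hp0 : ∀ m : ℕ, 0 ≤ (lam : ℝ) / (m + 1) := fun m => by positivity
  have hp1 : ∀ᶠ m : ℕ in atTop, (lam : ℝ) / (m + 1) ≤ 1 :=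
    hlim0.eventually_le_const one_pos
  have hlimS := tendsto_bernoulliStep_pow_poissonMeasure (lam := lam) (h := S)
    (.of_forall hp0) hp1 (by
      have := (tendsto_const_nhds (x := (lam : ℝ))).sub hlim0
      rw [sub_zero] at this
      refine this.congr fun m => ?_
      field_simp
      ring) hSB
  have hq1 : ∀ᶠ m : ℕ in atTop, (lam : ℝ) / m ≤ 1 :=
    (tendsto_const_div_atTop_nhds_zero_nat (lam : ℝ)).eventually_le_const one_pos
  have hlim : ∀ {h : ℕ → ℝ} {D : ℝ}, (∀ n, |h n| ≤ D) →
      Tendsto (fun m : ℕ => (bernoulliStep ((lam : ℝ) / (m + 1)) ^ (m + 1)) h 0) atTop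
        (𝓝 (∫ n, h n ∂(poissonMeasure lam))) := fun {h D} hD => by
    have := (tendsto_bernoulliStep_pow_poissonMeasure (lam := lam) (p := fun m => lam / m)
      (.of_forall fun m => by positivity) hq1 (by
        refine tendsto_const_nhds.congr' ?_
        filter_upwards [eventually_ne_atTop 0] with m hm
        field_simp) hD).comp (tendsto_add_atTop_nat 1)
    simpa [Function.comp_def] using this
  have hlimf := hlim hC
  have hmem : ∀ᶠ m : ℕ in atTop,
      (bernoulliStep ((lam : ℝ) / (m + 1)) ^ (m + 1)) f 0 ∈ I := by
    filter_upwards [hp1] with m hm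
    exact hI.bernoulliStep_pow_mem (hp0 m) hm _ hfI 0
  have hlimI := hIc.mem_of_tendsto hlimf hmem
  have hlimΦ := (hΦ.continuousOn _ hlimI).tendsto.comp
    (tendsto_nhdsWithin_iff.2 ⟨hlimf, hmem⟩)
  refine le_of_tendsto_of_tendsto ((hlim fun n => hA _ (hfK n)).sub hlimΦ)
    (hlimS.const_mul (lam : ℝ)) ?_
  filter_upwards [hp1] with m hm
  have := bernoulliStep_entropy_le hI hnonneg hconv (hp0 m) hm m hfI 0
  rwa [mul_div_cancel₀ _ (by positivity : (m : ℝ) + 1 ≠ 0)] at this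
end

section
/- Let I ⊆ ℝ be an open interval and Φ : I → ℝ a C⁴ function with Φ''(u) > 0 for all u ∈ I. Then the bivariate function (u,v) ↦ Φ''(u)·v² is convex on I × ℝ if and only if 1/Φ'' is concave on I (equivalently, Φ''(u)·Φ''''(u) ≥ 2·Φ'''(u)² for all u ∈ I). -/
/-- For `h > 0`, the map `(u, v) ↦ h u * v ^ 2` is jointly convex iff `1 / h` is concave. -/
theorem convexOn_mul_sq_iff_concaveOn_one_div {I : Set ℝ} (hI : Convex ℝ I) {h : ℝ → ℝ}
    (hpos : ∀ u ∈ I, 0 < h u) :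
    ConvexOn ℝ (I ×ˢ (Set.univ : Set ℝ)) (fun p : ℝ × ℝ => h p.1 * p.2 ^ 2)
      ↔ ConcaveOn ℝ I (fun u => 1 / h u) := by
  constructor
  · intro H
    refine ⟨hI, fun x hx y hy a b ha hb hab => ?_⟩
    have hz := hpos _ (hI hx hy ha hb hab)
    have hx0 := hpos x hx
    have hy0 := hpos y hy
    have key := H.2 (x := (x, 1 / h x)) (y := (y, 1 / h y)) ⟨hx, trivial⟩ ⟨hy, trivial⟩
      ha hb hab
    simp only [Prod.fst_add, Prod.snd_add, Prod.smul_fst, Prod.smul_snd, smul_eq_mul] at key hz ⊢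
    rw [show h x * (1 / h x) ^ 2 = 1 / h x by field_simp,
      show h y * (1 / h y) ^ 2 = 1 / h y by field_simp] at key
    have hs : 0 < a * (1 / h x) + b * (1 / h y) := by
      rcases ha.eq_or_lt with rfl | ha'
      · have : b = 1 := by linarith
        subst this
        simpa using hy0
      · positivity
    rw [le_div_iff₀ hz]
    nlinarith
  · intro H
    refine ⟨hI.prod convex_univ, ?_⟩
    rintro ⟨x, v⟩ ⟨hx, -⟩ ⟨y, w⟩ ⟨hy, -⟩ a b ha hb hab
    have hz := hpos _ (hI hx hy ha hb hab)
    have hx0 := hpos x hx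
    have hy0 := hpos y hy
    have key := H.2 hx hy ha hb hab
    simp only [Prod.fst_add, Prod.snd_add, Prod.smul_fst, Prod.smul_snd, smul_eq_mul] at key hz ⊢
    rw [le_div_iff₀ hz] at key
    have cauchy : (a * v + b * w) ^ 2 ≤
        (a * (1 / h x) + b * (1 / h y)) * (a * (h x * v ^ 2) + b * (h y * w ^ 2)) := by
      have : (a * (1 / h x) + b * (1 / h y)) * (a * (h x * v ^ 2) + b * (h y * w ^ 2))
          - (a * v + b * w) ^ 2 = a * b * (h x * v - h y * w) ^ 2 / (h x * h y) := by
        field_simp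
        ring
      have : 0 ≤ a * b * (h x * v - h y * w) ^ 2 / (h x * h y) := by positivity
      linarith
    have hN : 0 ≤ a * (h x * v ^ 2) + b * (h y * w ^ 2) := by positivity
    calc h (a * x + b * y) * (a * v + b * w) ^ 2
        ≤ h (a * x + b * y) * ((a * (1 / h x) + b * (1 / h y)) *
            (a * (h x * v ^ 2) + b * (h y * w ^ 2))) := by gcongr
      _ = ((a * (1 / h x) + b * (1 / h y)) * h (a * x + b * y)) *
            (a * (h x * v ^ 2) + b * (h y * w ^ 2)) := by ring
      _ ≤ 1 * (a * (h x * v ^ 2) + b * (h y * w ^ 2)) := by gcongr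
      _ = _ := one_mul _

/-- A twice differentiable function on an open convex set of reals is concave iff its second
derivative is nonpositive there. -/
theorem concaveOn_iff_deriv2_nonpos {I : Set ℝ} (hI : Convex ℝ I) (hIo : IsOpen I) {g : ℝ → ℝ}
    (hg : DifferentiableOn ℝ g I) (hg' : DifferentiableOn ℝ (deriv g) I) :
    ConcaveOn ℝ I g ↔ ∀ u ∈ I, deriv (deriv g) u ≤ 0 := by
  refine ⟨fun H u hu => ?_, fun H => concaveOn_of_deriv2_nonpos' hI hg hg' H⟩
  have hanti := H.antitoneOn_deriv fun x hx => hg.differentiableAt (hIo.mem_nhds hx)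
  rw [← derivWithin_of_isOpen hIo hu]
  exact hanti.derivWithin_nonpos

/-- For `h > 0` twice differentiable on an open convex set, `1 / h` is concave iff
`2 * h' ^ 2 ≤ h * h''`. -/
theorem concaveOn_one_div_iff_two_mul_deriv_sq_le {I : Set ℝ} (hI : Convex ℝ I)
    (hIo : IsOpen I) {h : ℝ → ℝ} (hpos : ∀ u ∈ I, 0 < h u) (hh : DifferentiableOn ℝ h I)
    (hh' : DifferentiableOn ℝ (deriv h) I) :
    ConcaveOn ℝ I (fun u => 1 / h u)
      ↔ ∀ u ∈ I, 2 * deriv h u ^ 2 ≤ h u * deriv (deriv h) u := by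
  have hd : ∀ u ∈ I, HasDerivAt h (deriv h u) u := fun u hu =>
    (hh.differentiableAt (hIo.mem_nhds hu)).hasDerivAt
  have hd' : ∀ u ∈ I, HasDerivAt (deriv h) (deriv (deriv h) u) u := fun u hu =>
    (hh'.differentiableAt (hIo.mem_nhds hu)).hasDerivAt
  have h1 : ∀ u ∈ I, HasDerivAt (fun u => 1 / h u) (-deriv h u / h u ^ 2) u := fun u hu => by
    simpa only [one_div] using (hd u hu).fun_inv (hpos u hu).ne'
  have h2 : ∀ u ∈ I, HasDerivAt (deriv fun u => 1 / h u)
      ((2 * deriv h u ^ 2 - h u * deriv (deriv h) u) / h u ^ 3) u := fun u hu => by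
    have hu0 := (hpos u hu).ne'
    have hq := ((hd' u hu).fun_neg.fun_div ((hd u hu).fun_pow 2) (pow_ne_zero 2 hu0))
    have he : (deriv fun u => 1 / h u) =ᶠ[nhds u] fun u => -deriv h u / h u ^ 2 := by
      filter_upwards [hIo.mem_nhds hu] with x hx using (h1 x hx).deriv
    refine (hq.congr_of_eventuallyEq he).congr_deriv ?_
    field_simp
    push_cast
    ring
  rw [concaveOn_iff_deriv2_nonpos hI hIo
    (fun u hu => (h1 u hu).differentiableAt.differentiableWithinAt)
    (fun u hu => (h2 u hu).differentiableAt.differentiableWithinAt)]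
  refine forall₂_congr fun u hu => ?_
  rw [(h2 u hu).deriv, div_le_iff₀ (pow_pos (hpos u hu) 3), zero_mul, sub_nonpos]

/-- **Characterisation of `(H1)` for positive `Φ''`.** For a `C⁴` function `Φ` on an open
interval `I` with `Φ'' > 0` on `I`, the bivariate map `(u,v) ↦ Φ''(u)·v²` is convex on
`I × ℝ` if and only if `1/Φ''` is concave on `I`, which holds if and only if
`Φ''·Φ'''' ≥ 2·(Φ''')²` on `I`. -/
theorem H1_iff_inv_second_deriv_concave
    (I : Set ℝ) (hI : Convex ℝ I) (hIo : IsOpen I) (hIne : I.Nonempty)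
    (Φ : ℝ → ℝ) (hΦ : ContDiffOn ℝ 4 Φ I)
    (hΦ'' : ∀ u ∈ I, 0 < deriv (deriv Φ) u) :
    (ConvexOn ℝ (I ×ˢ (Set.univ : Set ℝ))
        (fun p : ℝ × ℝ => deriv (deriv Φ) p.1 * p.2 ^ 2)
      ↔ ConcaveOn ℝ I (fun u => 1 / deriv (deriv Φ) u)) ∧
    (ConcaveOn ℝ I (fun u => 1 / deriv (deriv Φ) u)
      ↔ ∀ u ∈ I, 2 * (deriv (deriv (deriv Φ)) u) ^ 2
          ≤ deriv (deriv Φ) u * deriv (deriv (deriv (deriv Φ))) u) := by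
  have hΦ2 : ContDiffOn ℝ 2 (deriv (deriv Φ)) I :=
    (hΦ.deriv_of_isOpen (m := 3) hIo (by norm_num)).deriv_of_isOpen hIo (by norm_num)
  have hΦ3 : ContDiffOn ℝ 1 (deriv (deriv (deriv Φ))) I :=
    hΦ2.deriv_of_isOpen hIo (by norm_num)
  exact ⟨convexOn_mul_sq_iff_concaveOn_one_div hI hΦ'',
    concaveOn_one_div_iff_two_mul_deriv_sq_le hI hIo hΦ''
      (hΦ2.differentiableOn (by norm_num)) (hΦ3.differentiableOn (by norm_num))⟩
end
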